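/- arXiv:0904.0262 — 2 statements merged into one kernel-verified Lean document; each statement's English description precedes it below -/
import Mathlib

section
/- For all integers ℓ ≥ 3 and odd k ≥ 3, every finite set of at least (ℓ−1)(k−1)/2 + 1 points in the plane in convex position contains ℓ collinear points or k points in strictly convex position. -/
noncomputable section

/-- A point in the plane. -/
abbrev Pt : Type := EuclideanSpace ℝ (Fin 2)

noncomputable instance : DecidableEq Pt := Classical.decEq _

/-- A finite point set is in general position if no three of its points are collinear. -/
def GenPos (P : Finset Pt) : Prop :=
  ∀ S ⊆ P, S.card = 3 → ¬ Collinear ℝ (S : Set Pt)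

/-- A finite point set is in convex position if every point lies on the boundary
of the convex hull of the set. -/
def ConvexPos (P : Finset Pt) : Prop :=
  ∀ p ∈ P, p ∈ frontier (convexHull ℝ (P : Set Pt))

/-- `v` is a corner of `P` if removing it changes the convex hull. -/
def IsCornerOf (P : Finset Pt) (v : Pt) : Prop :=
  convexHull ℝ ((P : Set Pt) \ {v}) ≠ convexHull ℝ (P : Set Pt)

/-- A finite point set is in strictly convex position if each of its points is a corner. -/
def StrictConvexPos (P : Finset Pt) : Prop :=
  ∀ v ∈ P, IsCornerOf P v

/-- `P` contains `k` points in convex position. -/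
def HasConvex (P : Finset Pt) (k : ℕ) : Prop :=
  ∃ S ⊆ P, S.card = k ∧ ConvexPos S

/-- `P` contains `k` points in strictly convex position. -/
def HasStrictConvex (P : Finset Pt) (k : ℕ) : Prop :=
  ∃ S ⊆ P, S.card = k ∧ StrictConvexPos S

/-- `P` contains `l` collinear points. -/
def HasCollinear (P : Finset Pt) (l : ℕ) : Prop :=
  ∃ S ⊆ P, S.card = l ∧ Collinear ℝ (S : Set Pt)

/-- The Erdős–Szekeres number: the least `n` such that every finite set of at least `n`
points in general position contains `k` points in convex position. -/
def ES (k : ℕ) : ℕ :=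
  sInf {n : ℕ | ∀ P : Finset Pt, GenPos P → n ≤ P.card → HasConvex P k}

/-- `X` is a `k`-hole of `P`: `k` points of `P` in strictly convex position whose
convex hull contains no other point of `P`. -/
def IsHole (P X : Finset Pt) (k : ℕ) : Prop :=
  X ⊆ P ∧ X.card = k ∧ StrictConvexPos X ∧
    convexHull ℝ (X : Set Pt) ∩ (P : Set Pt) = (X : Set Pt)

/-- `v` and `w` are visible with respect to `P`. -/
def Visible (P : Finset Pt) (v w : Pt) : Prop :=
  v ≠ w ∧ (P : Set Pt) ∩ segment ℝ v w = {v, w}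

end


def cr (a b c : Pt) : ℝ := (b 0 - a 0) * (c 1 - a 1) - (b 1 - a 1) * (c 0 - a 0)

def Btw' (a m b : Pt) : Prop := ∃ c : ℝ, 0 < c ∧ c < 1 ∧ m 0 = a 0 + c * (b 0 - a 0) ∧
  m 1 = a 1 + c * (b 1 - a 1)

lemma pt_ext {a b : Pt} (h0 : a 0 = b 0) (h1 : a 1 = b 1) : a = b := by
  ext i; fin_cases i <;> assumption

lemma exists_param {a b x : Pt} (hab : a ≠ b) (h : cr a b x = 0) :
    ∃ r : ℝ, x 0 = a 0 + r * (b 0 - a 0) ∧ x 1 = a 1 + r * (b 1 - a 1) := by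
  unfold cr at h
  by_cases h0 : b 0 - a 0 = 0
  · have h1 : b 1 - a 1 ≠ 0 := fun h1 => hab (pt_ext (by linarith) (by linarith))
    refine ⟨(x 1 - a 1) / (b 1 - a 1), ?_, ?_⟩
    · rw [h0] at h ⊢
      have : (b 1 - a 1) * (x 0 - a 0) = 0 := by linarith
      rcases mul_eq_zero.1 this with h | h
      · exact absurd h h1
      · linarith
    · field_simp; ring
  · refine ⟨(x 0 - a 0) / (b 0 - a 0), ?_, ?_⟩
    · field_simp; ring
    · field_simp; linarith

lemma collinear_of_cr {a b : Pt} (hab : a ≠ b) (S : Set Pt)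
    (h : ∀ x ∈ S, cr a b x = 0) : Collinear ℝ S := by
  rw [collinear_iff_exists_forall_eq_smul_vadd]
  refine ⟨a, b - a, fun x hx => ?_⟩
  obtain ⟨r, h0, h1⟩ := exists_param hab (h x hx)
  refine ⟨r, pt_ext ?_ ?_⟩
  · simp [h0]; ring
  · simp [h1]; ring

lemma trich {a b c : Pt} (hab : a ≠ b) (hac : a ≠ c) (hbc : b ≠ c) (h : cr a b c = 0) :
    Btw' a b c ∨ Btw' b c a ∨ Btw' c a b := by
  have h' : cr a c b = 0 := by unfold cr at *; linarith
  obtain ⟨r, h0, h1⟩ := exists_param hac h'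
  rcases lt_trichotomy r 0 with hr | hr | hr
  · right; right
    have : (0:ℝ) < 1 - r := by linarith
    refine ⟨1 / (1 - r), by positivity, by rw [div_lt_one this]; linarith, ?_, ?_⟩
    · rw [h0]; field_simp; ring
    · rw [h1]; field_simp; ring
  · exact absurd (pt_ext (by rw [h0, hr]; ring) (by rw [h1, hr]; ring)) hab
  · rcases lt_trichotomy r 1 with hr1 | hr1 | hr1
    · left; exact ⟨r, hr, hr1, h0, h1⟩
    · exact absurd (pt_ext (by rw [h0, hr1]; ring) (by rw [h1, hr1]; ring)) hbc
    · right; left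
      refine ⟨1 - 1 / r, ?_, ?_, ?_, ?_⟩
      · have : 1 / r < 1 := by rw [div_lt_one hr]; exact hr1
        linarith
      · have : 0 < 1 / r := by positivity
        linarith
      · rw [h0]; field_simp; ring
      · rw [h1]; field_simp; ring

lemma btw_zero {a m b x : Pt} (h : Btw' a m b)
    (hx : (0 ≤ cr a m x ∧ 0 ≤ cr b m x) ∨ (cr a m x ≤ 0 ∧ cr b m x ≤ 0)) :
    cr a b x = 0 := by
  obtain ⟨c, hc0, hc1, h0, h1⟩ := h
  have e1 : cr a m x = c * cr a b x := by unfold cr; rw [h0, h1]; ring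
  have e2 : cr b m x = -((1 - c) * cr a b x) := by unfold cr; rw [h0, h1]; ring
  rw [e1, e2] at hx
  have : 0 < 1 - c := by linarith
  rcases hx with ⟨ha, hb⟩ | ⟨ha, hb⟩
  · have := nonneg_of_mul_nonneg_right ha hc0
    by_contra hne
    have h3 : 0 < cr a b x := lt_of_le_of_ne this (Ne.symm hne)
    nlinarith [mul_pos ‹0 < 1 - c› h3]
  · by_contra hne
    rcases lt_or_gt_of_ne hne with h3 | h3
    · nlinarith [mul_pos ‹0 < 1 - c› (neg_pos.2 h3)]
    · nlinarith [mul_pos hc0 h3]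

lemma cr_rot (a b c : Pt) : cr b c a = cr a b c := by unfold cr; ring
lemma cr_swap (a b c : Pt) : cr a c b = - cr a b c := by unfold cr; ring
lemma cr_swap1 (a b c : Pt) : cr b a c = - cr a b c := by unfold cr; ring
lemma cr_self1 (a c : Pt) : cr a a c = 0 := by unfold cr; ring
lemma cr_self2 (a c : Pt) : cr a c a = 0 := by unfold cr; ring
lemma cr_self3 (a c : Pt) : cr a c c = 0 := by unfold cr; ring

lemma strict_of_pos (b : ℕ → Pt) (N : ℕ) (hN : 3 ≤ N)
    (hpos : ∀ i j k, i < j → j < k → k < N → 0 < cr (b i) (b j) (b k)) :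
    StrictConvexPos ((Finset.range N).image b) := by
  have sep : ∀ v u w : Pt, v ∈ ((Finset.range N).image b) → cr u w v < 0 →
      (∀ x ∈ ((Finset.range N).image b), x ≠ v → 0 ≤ cr u w x) →
      IsCornerOf ((Finset.range N).image b) v := by
    intro v u w hv hneg hall heq
    have hv' : v ∈ convexHull ℝ ((((Finset.range N).image b : Finset Pt) : Set Pt) \ {v}) := by
      rw [heq]; exact subset_convexHull ℝ _ hv
    have hsub : convexHull ℝ ((((Finset.range N).image b : Finset Pt) : Set Pt) \ {v}) ⊆
        {x | 0 ≤ cr u w x} := by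
      apply convexHull_min
      · rintro x ⟨hx, hxv⟩
        exact hall x hx hxv
      · intro x hx y hy s t hs ht hst
        simp only [Set.mem_setOf_eq] at *
        have : cr u w (s • x + t • y) = s * cr u w x + t * cr u w y := by
          have hs' : s = 1 - t := by linarith
          unfold cr; simp; rw [hs']; ring
        rw [this]; positivity
    have := hsub hv'
    simp only [Set.mem_setOf_eq] at this
    linarith
  intro v hv
  obtain ⟨t, ht, rfl⟩ := Finset.mem_image.1 hv
  rw [Finset.mem_range] at ht
  by_cases h0 : t = 0
  · subst h0
    refine sep _ (b (N-1)) (b 1) hv ?_ ?_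
    · have := hpos 0 1 (N-1) (by omega) (by omega) (by omega)
      unfold cr at *; linarith
    · intro x hx hxv
      obtain ⟨y, hy, rfl⟩ := Finset.mem_image.1 hx
      rw [Finset.mem_range] at hy
      have hy0 : y ≠ 0 := fun h => hxv (by rw [h])
      by_cases h1 : y = 1
      · subst h1; rw [cr_self3]
      by_cases h2 : y = N - 1
      · rw [h2, cr_self2]
      have := hpos 1 y (N-1) (by omega) (by omega) (by omega)
      unfold cr at *; linarith
  by_cases h1 : t = N - 1
  · subst h1
    refine sep _ (b (N-2)) (b 0) hv ?_ ?_
    · have := hpos 0 (N-2) (N-1) (by omega) (by omega) (by omega)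
      unfold cr at *; linarith
    · intro x hx hxv
      obtain ⟨y, hy, rfl⟩ := Finset.mem_image.1 hx
      rw [Finset.mem_range] at hy
      have hy0 : y ≠ N - 1 := fun h => hxv (by rw [h])
      by_cases h1 : y = 0
      · subst h1; rw [cr_self3]
      by_cases h2 : y = N - 2
      · rw [h2, cr_self2]
      have := hpos 0 y (N-2) (by omega) (by omega) (by omega)
      unfold cr at *; linarith
  · refine sep _ (b (t-1)) (b (t+1)) hv ?_ ?_
    · have := hpos (t-1) t (t+1) (by omega) (by omega) (by omega)
      unfold cr at *; linarith
    · intro x hx hxv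
      obtain ⟨y, hy, rfl⟩ := Finset.mem_image.1 hx
      rw [Finset.mem_range] at hy
      have hy0 : y ≠ t := fun h => hxv (by rw [h])
      by_cases h1 : y = t + 1
      · subst h1; rw [cr_self3]
      by_cases h2 : y = t - 1
      · rw [h2, cr_self2]
      rcases lt_or_gt_of_ne hy0 with h | h
      · have := hpos y (t-1) (t+1) (by omega) (by omega) (by omega)
        unfold cr at *; linarith
      · have := hpos (t-1) (t+1) y (by omega) (by omega) (by omega)
        unfold cr at *; linarith

lemma select (P : Finset Pt) (l m : ℕ) (hl : 3 ≤ l) (hm : 1 ≤ m) (n : ℕ)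
    (hn : (l - 1) * m + 1 ≤ n) (p : ℕ → Pt) (hP : ∀ i < n, p i ∈ P)
    (hinj : ∀ i < n, ∀ j < n, p i = p j → i = j)
    (hD : ∀ i j k, i < j → j < k → k < n → 0 ≤ cr (p i) (p j) (p k))
    (h0 : ∀ i < n, ∀ j < n, i ≠ 0 → j ≠ 0 → ¬ Btw' (p i) (p 0) (p j)) :
    HasCollinear P l ∨ HasStrictConvex P (2 * m + 1) := by
  by_cases hcol : HasCollinear P l
  · exact Or.inl hcol
  right
  -- collinear index sets are small
  have small : ∀ (I : Finset ℕ), (∀ i ∈ I, i < n) → l ≤ I.card →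
      ∀ a b : Pt, a ≠ b → (∀ i ∈ I, cr a b (p i) = 0) → False := by
    intro I hI hc a b hab hz
    obtain ⟨J, hJI, hJ⟩ := Finset.exists_subset_card_eq hc
    apply hcol
    refine ⟨J.image p, ?_, ?_, ?_⟩
    · intro x hx
      obtain ⟨i, hi, rfl⟩ := Finset.mem_image.1 hx
      exact hP i (hI i (hJI hi))
    · rw [Finset.card_image_of_injOn, hJ]
      intro i hi j hj hij
      exact hinj i (hI i (hJI hi)) j (hI j (hJI hj)) hij
    · apply collinear_of_cr hab
      intro x hx
      obtain ⟨i, hi, rfl⟩ := Finset.mem_image.1 (Finset.mem_coe.1 hx)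
      exact hz i (hJI hi)
  obtain ⟨d, rfl⟩ : ∃ d, l = d + 1 := ⟨l - 1, by omega⟩
  simp only [Nat.add_sub_cancel] at hn
  let a : ℕ → ℕ := fun t => (t / 2) * d + t % 2
  have a2 : ∀ t, a (t + 2) = a t + d := by
    intro t
    have h1 : (t + 2) / 2 = t / 2 + 1 := by omega
    have h2 : (t + 2) % 2 = t % 2 := by omega
    simp only [a, h1, h2]; ring
  have amono : StrictMono a := by
    apply strictMono_nat_of_lt_succ
    intro t
    rcases Nat.even_or_odd' t with ⟨c, rfl | rfl⟩
    · have h1 : (2 * c + 1) / 2 = c := by omega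
      have h2 : (2 * c) / 2 = c := by omega
      have h3 : (2 * c) % 2 = 0 := by omega
      have h4 : (2 * c + 1) % 2 = 1 := by omega
      simp only [a, h1, h2, h3, h4]; omega
    · have h1 : (2 * c + 1) / 2 = c := by omega
      have h2 : (2 * c + 1 + 1) / 2 = c + 1 := by omega
      have h3 : (2 * c + 1 + 1) % 2 = 0 := by omega
      have h4 : (2 * c + 1) % 2 = 1 := by omega
      simp only [a, h1, h2, h3, h4]
      have : (c + 1) * d = c * d + d := by ring
      omega
  have alast : a (2 * m) = d * m := by
    have h2 : (2 * m) / 2 = m := by omega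
    have h3 : (2 * m) % 2 = 0 := by omega
    simp only [a, h2, h3]; ring
  have alast1 : a (2 * m - 1) + d = d * m + 1 := by
    rw [← a2]
    have h2 : (2 * m - 1 + 2) / 2 = m := by omega
    have h3 : (2 * m - 1 + 2) % 2 = 1 := by omega
    simp only [a, h2, h3]; ring
  have a00 : a 0 = 0 := by simp [a]
  have a22 : a 2 = d := by have := a2 0; simp only [zero_add] at this; omega
  have aN : ∀ t < 2 * m + 1, a t < n := by
    intro t ht
    have := amono.monotone (show t ≤ 2 * m by omega)
    omega
  have hpos : ∀ t u v, t < u → u < v → v < 2 * m + 1 →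
      0 < cr (p (a t)) (p (a u)) (p (a v)) := by
    intro t u v htu huv hv
    have hij := amono htu
    have hjk := amono huv
    have hkn := aN v hv
    have f1 : a t + d ≤ a v := by
      rw [← a2]; exact amono.monotone (by omega)
    have f2 : a u + d ≤ d * m + 1 := by
      rw [← alast1]
      exact Nat.add_le_add_right (amono.monotone (by omega)) _
    have f3 : a t ≠ 0 → d ≤ a u := by
      intro h
      have : t ≠ 0 := fun h' => h (by rw [h', a00])
      rw [← a22]; exact amono.monotone (by omega)
    generalize a t = i at *
    generalize a u = j at *
    generalize a v = k at *
    refine lt_of_le_of_ne (hD i j k hij hjk hkn) fun hz => ?_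
    have nij : p i ≠ p j := fun h => by have := hinj i (by omega) j (by omega) h; omega
    have nik : p i ≠ p k := fun h => by have := hinj i (by omega) k (by omega) h; omega
    have njk : p j ≠ p k := fun h => by have := hinj j (by omega) k (by omega) h; omega
    rcases trich nij nik njk hz.symm with hb | hb | hb
    · refine small (Finset.Icc i k) ?_ ?_ _ _ nik ?_
      · intro x hx; rw [Finset.mem_Icc] at hx; omega
      · rw [Nat.card_Icc]; omega
      · intro x hx; rw [Finset.mem_Icc] at hx
        by_cases e1 : x = i
        · rw [e1, cr_self2]
        by_cases e2 : x = k
        · rw [e2, cr_self3]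
        apply btw_zero hb
        rcases lt_trichotomy x j with h | h | h
        · have := hD i x j (by omega) (by omega) (by omega)
          have := hD x j k (by omega) (by omega) (by omega)
          right; unfold cr at *; constructor <;> linarith
        · subst h; left; simp [cr_self3]
        · have := hD i j x (by omega) (by omega) (by omega)
          have := hD j x k (by omega) (by omega) (by omega)
          left; unfold cr at *; constructor <;> linarith
    · refine small (Finset.Iic i ∪ Finset.Ico j n) ?_ ?_ _ _ nij.symm ?_
      · intro x hx; rw [Finset.mem_union, Finset.mem_Iic, Finset.mem_Ico] at hx; omega
      · rw [Finset.card_union_of_disjoint, Nat.card_Iic, Nat.card_Ico]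
        · omega
        · rw [Finset.disjoint_left]; intro x; simp; omega
      · intro x hx; rw [Finset.mem_union, Finset.mem_Iic, Finset.mem_Ico] at hx
        by_cases e1 : x = i
        · rw [e1, cr_self3]
        by_cases e2 : x = j
        · rw [e2, cr_self2]
        by_cases e3 : x = k
        · rw [e3]; unfold cr at *; linarith
        apply btw_zero hb
        rcases hx with hx | hx
        · have := hD x j k (by omega) (by omega) (by omega)
          have := hD x i k (by omega) (by omega) (by omega)
          left; unfold cr at *; constructor <;> linarith
        rcases lt_or_gt_of_ne e3 with h | h
        · have := hD i x k (by omega) (by omega) (by omega)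
          have := hD j x k (by omega) (by omega) (by omega)
          right; unfold cr at *; constructor <;> linarith
        · have := hD i k x (by omega) (by omega) (by omega)
          have := hD j k x (by omega) (by omega) (by omega)
          left; unfold cr at *; constructor <;> linarith
    · have hi0 : i ≠ 0 := by
        rintro rfl
        exact h0 k (by omega) j (by omega) (by omega) (by omega) hb
      refine small (Finset.Iic j ∪ Finset.Ico k n) ?_ ?_ _ _ njk.symm ?_
      · intro x hx; rw [Finset.mem_union, Finset.mem_Iic, Finset.mem_Ico] at hx; omega
      · rw [Finset.card_union_of_disjoint, Nat.card_Iic, Nat.card_Ico]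
        · have := f3 hi0; omega
        · rw [Finset.disjoint_left]; intro x; simp; omega
      · intro x hx; rw [Finset.mem_union, Finset.mem_Iic, Finset.mem_Ico] at hx
        by_cases e1 : x = j
        · rw [e1, cr_self3]
        by_cases e2 : x = k
        · rw [e2, cr_self2]
        by_cases e3 : x = i
        · rw [e3]; unfold cr at *; linarith
        apply btw_zero hb
        rcases hx with hx | hx
        · rcases lt_or_gt_of_ne e3 with h | h
          · have := hD x i j (by omega) (by omega) (by omega)
            have := hD x i k (by omega) (by omega) (by omega)
            right; unfold cr at *; constructor <;> linarith
          · have := hD i x j (by omega) (by omega) (by omega)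
            have := hD i x k (by omega) (by omega) (by omega)
            left; unfold cr at *; constructor <;> linarith
        · have := hD i k x (by omega) (by omega) (by omega)
          have := hD i j x (by omega) (by omega) (by omega)
          right; unfold cr at *; constructor <;> linarith
  refine ⟨(Finset.range (2 * m + 1)).image (fun t => p (a t)), ?_, ?_, ?_⟩
  · intro x hx
    obtain ⟨i, hi, rfl⟩ := Finset.mem_image.1 hx
    exact hP _ (aN i (Finset.mem_range.1 hi))
  · rw [Finset.card_image_of_injOn, Finset.card_range]
    intro i hi j hj hij
    exact amono.injective (hinj _ (aN i (Finset.mem_range.1 hi)) _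
      (aN j (Finset.mem_range.1 hj)) hij)
  · exact strict_of_pos (fun t => p (a t)) (2 * m + 1) (by omega) hpos

lemma support (P : Finset Pt) (hconv : ConvexPos P) (hnc : ¬ Collinear ℝ (P : Set Pt)) :
    ∀ q ∈ P, ∃ α β : ℝ, (α ≠ 0 ∨ β ≠ 0) ∧
      ∀ x ∈ P, 0 ≤ α * (x 0 - q 0) + β * (x 1 - q 1) := by
  have htop : affineSpan ℝ (P : Set Pt) = ⊤ := by
    have hf := (collinear_iff_finrank_le_one (k := ℝ) (s := (P : Set Pt))).not.1 hnc
    push Not at hf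
    have hne : (P : Set Pt).Nonempty := by
      by_contra h
      rw [Set.not_nonempty_iff_eq_empty] at h
      rw [h] at hnc; exact hnc (collinear_empty ℝ _)
    have hd : Module.finrank ℝ Pt = 2 := by simp
    have hv : vectorSpan ℝ (P : Set Pt) = ⊤ := by
      apply Submodule.eq_top_of_finrank_eq
      have := Submodule.finrank_le (vectorSpan ℝ (P : Set Pt))
      omega
    exact (AffineSubspace.affineSpan_eq_top_iff_vectorSpan_eq_top_of_nonempty ℝ Pt Pt hne).2 hv
  have hint : (interior (convexHull ℝ (P : Set Pt))).Nonempty :=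
    interior_convexHull_nonempty_iff_affineSpan_eq_top.2 htop
  intro q hq
  have hqf := hconv q hq
  obtain ⟨f, hf⟩ := geometric_hahn_banach_open_point (convex_convexHull ℝ (P : Set Pt)).interior
    isOpen_interior hqf.2
  have hcl : ∀ x ∈ P, f x ≤ f q := by
    intro x hx
    have hx' : x ∈ closure (interior (convexHull ℝ (P : Set Pt))) := by
      rw [(convex_convexHull ℝ (P : Set Pt)).closure_interior_eq_closure_of_nonempty_interior hint]
      exact subset_closure (subset_convexHull ℝ _ hx)
    exact closure_minimal (fun y hy => (hf y hy).le)
      (isClosed_le f.continuous continuous_const) hx'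
  have hlin : ∀ x : Pt, f x = x 0 * f (!₂[1,0]) + x 1 * f (!₂[0,1]) := by
    intro x
    have : x = x 0 • (!₂[1,0] : Pt) + x 1 • (!₂[0,1] : Pt) := by
      apply pt_ext <;> simp
    conv_lhs => rw [this]
    simp
  refine ⟨-f (!₂[1,0]), -f (!₂[0,1]), ?_, ?_⟩
  · by_contra h
    push Not at h
    obtain ⟨y, hy⟩ := hint
    have h1 := hf y hy
    rw [hlin y, hlin q] at h1
    have e1 := neg_eq_zero.1 h.1
    have e2 := neg_eq_zero.1 h.2
    rw [e1, e2] at h1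
    simp at h1
  · intro x hx
    have h1 := hcl x hx
    rw [hlin x, hlin q] at h1
    linarith

def Rl (A B : ℝ) (o f q r : Pt) : Prop := 0 < cr o q r ∨ (cr o q r = 0 ∧
  ((cr o f q = 0 ∧ A * (q 0 - o 0) + B * (q 1 - o 1) < A * (r 0 - o 0) + B * (r 1 - o 1)) ∨
   (0 < cr o f q ∧ A * (r 0 - o 0) + B * (r 1 - o 1) < A * (q 0 - o 0) + B * (q 1 - o 1))))

lemma lin_zero {α β a b c d : ℝ} (h1 : α * a + β * b = 0) (h2 : α * c + β * d = 0)
    (h : a * d - b * c ≠ 0) : α = 0 ∧ β = 0 := by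
  constructor
  · have : α * (a * d - b * c) = 0 := by linear_combination d * h1 - b * h2
    exact (mul_eq_zero.1 this).resolve_right h
  · have : β * (a * d - b * c) = 0 := by linear_combination a * h2 - c * h1
    exact (mul_eq_zero.1 this).resolve_right h

lemma scale {A B : ℝ} {o q r : Pt} (hq : 0 < A * (q 0 - o 0) + B * (q 1 - o 1))
    (hr : 0 < A * (r 0 - o 0) + B * (r 1 - o 1)) (h : cr o q r = 0) :
    ∃ c : ℝ, 0 < c ∧ r 0 = o 0 + c * (q 0 - o 0) ∧ r 1 = o 1 + c * (q 1 - o 1) ∧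
      A * (r 0 - o 0) + B * (r 1 - o 1) = c * (A * (q 0 - o 0) + B * (q 1 - o 1)) := by
  have hne : o ≠ q := by rintro rfl; simp at hq
  obtain ⟨c, h0, h1⟩ := exists_param hne h
  have e : A * (r 0 - o 0) + B * (r 1 - o 1) = c * (A * (q 0 - o 0) + B * (q 1 - o 1)) := by
    rw [h0, h1]; ring
  refine ⟨c, ?_, h0, h1, e⟩
  rw [e] at hr
  exact pos_of_mul_pos_left hr hq.le

lemma three {A B : ℝ} {o f q r w : Pt}
    (hX : ∀ x, x = f ∨ x = q ∨ x = r ∨ x = w → 0 < A * (x 0 - o 0) + B * (x 1 - o 1))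
    (hsup : ∃ α β : ℝ, (α ≠ 0 ∨ β ≠ 0) ∧
      ∀ x, x = o ∨ x = f ∨ x = q ∨ x = w → 0 ≤ α * (x 0 - r 0) + β * (x 1 - r 1))
    (hfq : 0 ≤ cr o f q)
    (h1 : Rl A B o f q r) (h2 : Rl A B o f r w) : 0 ≤ cr q r w := by
  have Xf := hX f (by simp)
  have Xq := hX q (by simp)
  have Xr := hX r (by simp)
  have Xw := hX w (by simp)
  obtain ⟨α, β, hne, hs⟩ := hsup
  have so := hs o (by simp)
  have sf := hs f (by simp)
  have sq := hs q (by simp)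
  have sw := hs w (by simp)
  rcases h1 with h1 | ⟨h1, h1'⟩
  · rcases h2 with h2 | ⟨h2, h2'⟩
    · by_contra hneg
      push Not at hneg
      have id : cr o r w * (α * (q 0 - r 0) + β * (q 1 - r 1))
        + cr o q r * (α * (w 0 - r 0) + β * (w 1 - r 1))
        + (- cr q r w) * (α * (o 0 - r 0) + β * (o 1 - r 1)) = 0 := by
        unfold cr; ring
      have p1 := mul_nonneg h2.le sq
      have p2 := mul_nonneg h1.le sw
      have p3 := mul_nonneg (neg_pos.2 hneg).le so
      have z1 : cr o r w * (α * (q 0 - r 0) + β * (q 1 - r 1)) = 0 := by linarith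
      have z3 : (- cr q r w) * (α * (o 0 - r 0) + β * (o 1 - r 1)) = 0 := by linarith
      have y1 := (mul_eq_zero.1 z1).resolve_left h2.ne'
      have y3 := (mul_eq_zero.1 z3).resolve_left (neg_pos.2 hneg).ne'
      have := lin_zero y1 y3 (by unfold cr at h1; intro h; linarith)
      simp [this.1, this.2] at hne
    · obtain ⟨c, hc, e0, e1, e⟩ := scale Xr Xw h2
      have hfr : 0 < cr o f r := by
        -- slope of r is above slope of q
        have id : cr o f r * (A * (q 0 - o 0) + B * (q 1 - o 1)) =
          cr o f q * (A * (r 0 - o 0) + B * (r 1 - o 1)) +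
          cr o q r * (A * (f 0 - o 0) + B * (f 1 - o 1)) := by unfold cr; ring
        have p1 := mul_nonneg hfq Xr.le
        have p2 := mul_pos h1 Xf
        exact pos_of_mul_pos_left (by rw [id]; linarith) Xq.le
      have hc1 : c < 1 := by
        rcases h2' with ⟨h3, h4⟩ | ⟨h3, h4⟩
        · linarith
        · rw [e] at h4; by_contra hh; push Not at hh; nlinarith
      have : cr q r w = (1 - c) * cr o q r := by unfold cr; rw [e0, e1]; ring
      rw [this]; exact mul_nonneg (by linarith) h1.le
  · obtain ⟨c, hc, e0, e1, e⟩ := scale Xq Xr h1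
    rcases h2 with h2 | ⟨h2, h2'⟩
    · have id : cr q r w = (c - 1) * cr o q w := by unfold cr; rw [e0, e1]; ring
      have id2 : cr o r w = c * cr o q w := by unfold cr; rw [e0, e1]; ring
      rw [id2] at h2
      have hqw := pos_of_mul_pos_right h2 hc.le
      rcases h1' with ⟨h3, h4⟩ | ⟨h3, h4⟩
      · have hc1 : 1 < c := by
          rw [e] at h4; by_contra hh; push Not at hh; nlinarith
        rw [id]; exact mul_nonneg (by linarith) hqw.le
      · exfalso
        have hc1 : c < 1 := by
          rw [e] at h4; by_contra hh; push Not at hh; nlinarith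
        rw [e0, e1] at so sf sq sw
        have s1 : 0 ≤ (1 - c) * (α * (q 0 - o 0) + β * (q 1 - o 1)) := by linarith
        have s2 : 0 ≤ c * (-(α * (q 0 - o 0) + β * (q 1 - o 1))) := by linarith
        have s1' := nonneg_of_mul_nonneg_right s1 (by linarith)
        have s2' := nonneg_of_mul_nonneg_right s2 hc
        have z : α * (q 0 - o 0) + β * (q 1 - o 1) = 0 := by linarith
        have sf' : 0 ≤ α * (f 0 - o 0) + β * (f 1 - o 1) := by
          have := congrArg (fun t => c * t) z; simp only at this; linarith
        have sw' : 0 ≤ α * (w 0 - o 0) + β * (w 1 - o 1) := by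
          have := congrArg (fun t => c * t) z; simp only at this; linarith
        have idd : cr o q w * (α * (f 0 - o 0) + β * (f 1 - o 1))
          + cr o f q * (α * (w 0 - o 0) + β * (w 1 - o 1)) =
            cr o f w * (α * (q 0 - o 0) + β * (q 1 - o 1)) := by unfold cr; ring
        rw [z, mul_zero] at idd
        have p1 := mul_nonneg hqw.le sf'
        have p2 := mul_nonneg h3.le sw'
        have z2 : cr o f q * (α * (w 0 - o 0) + β * (w 1 - o 1)) = 0 := by linarith
        have y2 := (mul_eq_zero.1 z2).resolve_left h3.ne'
        have := lin_zero z y2 (by unfold cr at hqw; intro h; linarith)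
        simp [this.1, this.2] at hne
    · obtain ⟨c', hc', e0', e1', e'⟩ := scale Xr Xw h2
      have : cr q r w = 0 := by unfold cr; rw [e0', e1', e0, e1]; ring
      rw [this]

lemma enum (P : Finset Pt) (hne : P.Nonempty) (hsup : ∀ q ∈ P, ∃ α β : ℝ, (α ≠ 0 ∨ β ≠ 0) ∧
      ∀ x ∈ P, 0 ≤ α * (x 0 - q 0) + β * (x 1 - q 1)) :
    ∃ p : ℕ → Pt, (∀ i < P.card, p i ∈ P) ∧
    (∀ i < P.card, ∀ j < P.card, p i = p j → i = j) ∧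
    (∀ i j k, i < j → j < k → k < P.card → 0 ≤ cr (p i) (p j) (p k)) ∧
    (∀ i < P.card, ∀ j < P.card, i ≠ 0 → j ≠ 0 → ¬ Btw' (p i) (p 0) (p j)) := by
  obtain ⟨o, hoP, hmax⟩ := P.exists_max_image (fun q => q 0 ^ 2 + q 1 ^ 2) hne
  obtain ⟨A, hA⟩ : ∃ A, A = - o 0 := ⟨_, rfl⟩
  obtain ⟨B, hB⟩ : ∃ B, B = - o 1 := ⟨_, rfl⟩
  have hX : ∀ x ∈ P.erase o, 0 < A * (x 0 - o 0) + B * (x 1 - o 1) := by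
    intro x hx
    rw [Finset.mem_erase] at hx
    have h1 := hmax x hx.2
    simp only at h1
    have h2 : 0 < (x 0 - o 0) ^ 2 + (x 1 - o 1) ^ 2 := by
      by_contra h
      have a1 : (x 0 - o 0) ^ 2 = 0 := by nlinarith [sq_nonneg (x 0 - o 0), sq_nonneg (x 1 - o 1)]
      have a2 : (x 1 - o 1) ^ 2 = 0 := by nlinarith [sq_nonneg (x 0 - o 0), sq_nonneg (x 1 - o 1)]
      have b1 := pow_eq_zero_iff (two_ne_zero) |>.1 a1
      have b2 := pow_eq_zero_iff (two_ne_zero) |>.1 a2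
      exact hx.1 (pt_ext (by linarith) (by linarith))
    rw [hA, hB]; nlinarith
  clear hA hB
  by_cases hP' : (P.erase o).Nonempty
  swap
  · rw [Finset.not_nonempty_iff_eq_empty] at hP'
    have hc : P.card = 1 := by
      have := Finset.card_erase_add_one hoP
      rw [hP'] at this; simpa using this.symm
    refine ⟨fun _ => o, fun _ _ => hoP, ?_, ?_, ?_⟩ <;> intros <;> omega
  let X : Pt → ℝ := fun x => A * (x 0 - o 0) + B * (x 1 - o 1)
  let Y : Pt → ℝ := fun x => A * (x 1 - o 1) - B * (x 0 - o 0)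
  have hAB : 0 < A ^ 2 + B ^ 2 := by
    obtain ⟨x, hx⟩ := hP'
    have := hX x hx
    by_contra h
    have a1 : A ^ 2 = 0 := by nlinarith [sq_nonneg A, sq_nonneg B]
    have a2 : B ^ 2 = 0 := by nlinarith [sq_nonneg A, sq_nonneg B]
    have b1 := pow_eq_zero_iff (two_ne_zero) |>.1 a1
    have b2 := pow_eq_zero_iff (two_ne_zero) |>.1 a2
    rw [b1, b2] at this; simp at this
  have hXY : ∀ q r, X q * Y r - X r * Y q = (A ^ 2 + B ^ 2) * cr o q r := by
    intro q r; simp only [X, Y, cr]; ring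
  have hslt : ∀ q ∈ P.erase o, ∀ r ∈ P.erase o, (Y q / X q < Y r / X r ↔ 0 < cr o q r) := by
    intro q hq r hr
    rw [div_lt_div_iff₀ (hX q hq) (hX r hr)]
    have := hXY q r
    constructor
    · intro h
      by_contra h'
      push Not at h'
      nlinarith
    · intro h
      nlinarith [mul_pos hAB h]
  have hseq : ∀ q ∈ P.erase o, ∀ r ∈ P.erase o, (Y q / X q = Y r / X r → cr o q r = 0) := by
    intro q hq r hr h
    rw [div_eq_div_iff (hX q hq).ne' (hX r hr).ne'] at h
    have := hXY q r
    have h2 : (A ^ 2 + B ^ 2) * cr o q r = 0 := by rw [← this]; linarith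
    exact (mul_eq_zero.1 h2).resolve_left hAB.ne'
  obtain ⟨f, hfP, hmin⟩ := (P.erase o).exists_min_image (fun q => Y q / X q) hP'
  have hf : ∀ q ∈ P.erase o, 0 ≤ cr o f q := by
    intro q hq
    rcases (hmin q hq).lt_or_eq with h | h
    · exact ((hslt f hfP q hq).1 h).le
    · exact (hseq f hfP q hq h).ge
  let key : Pt → ℝ ×ₗ ℝ := fun q => toLex (Y q / X q, if cr o f q = 0 then X q else - X q)
  have hkey : ∀ q ∈ P.erase o, ∀ r ∈ P.erase o, key q < key r → Rl A B o f q r := by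
    intro q hq r hr h
    rw [Prod.Lex.toLex_lt_toLex] at h
    rcases h with h | ⟨h, h'⟩
    · exact Or.inl ((hslt q hq r hr).1 h)
    · right
      simp only at h h'
      refine ⟨hseq q hq r hr h, ?_⟩
      obtain ⟨c, hc, e0, e1, e⟩ := scale (hX q hq) (hX r hr) (hseq q hq r hr h)
      have hfr : cr o f r = c * cr o f q := by unfold cr; rw [e0, e1]; ring
      by_cases hz : cr o f q = 0
      · left
        rw [hfr, hz] at h'
        simp only [mul_zero, if_true] at h'
        exact ⟨hz, h'⟩
      · right
        have hz' : cr o f r ≠ 0 := by rw [hfr]; exact mul_ne_zero hc.ne' hz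
        rw [if_neg hz, if_neg hz'] at h'
        exact ⟨lt_of_le_of_ne (hf q hq) (Ne.symm hz), neg_lt_neg_iff.1 h'⟩
  have hkinj : Set.InjOn key (P.erase o : Finset Pt) := by
    intro q hq r hr h
    have hq' := Finset.mem_coe.1 hq
    have hr' := Finset.mem_coe.1 hr
    have h' := toLex.injective h
    rw [Prod.mk.injEq] at h'
    obtain ⟨h1, h2⟩ := h'
    obtain ⟨c, hc, e0, e1, e⟩ := scale (hX q hq') (hX r hr') (hseq q hq' r hr' h1)
    have hfr : cr o f r = c * cr o f q := by unfold cr; rw [e0, e1]; ring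
    have hXX : X q = X r := by
      by_cases hz : cr o f q = 0
      · rw [hfr, hz] at h2; simpa using h2
      · have hz' : cr o f r ≠ 0 := by rw [hfr]; exact mul_ne_zero hc.ne' hz
        rw [if_neg hz, if_neg hz'] at h2
        linarith
    have hXq : 0 < X q := hX q hq'
    have hc1 : c = 1 := by
      have : X r = c * X q := e
      rw [← hXX] at this
      have : (c - 1) * X q = 0 := by linarith
      have := (mul_eq_zero.1 this).resolve_right hXq.ne'
      linarith
    subst hc1
    exact pt_ext (by rw [e0]; ring) (by rw [e1]; ring)
  have hcard : ((P.erase o).image key).card = P.card - 1 := by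
    rw [Finset.card_image_of_injOn hkinj, Finset.card_erase_of_mem hoP]
  let e := ((P.erase o).image key).orderEmbOfFin hcard
  have he : ∀ i : Fin (P.card - 1), ∃ q ∈ P.erase o, key q = e i := by
    intro i
    exact Finset.mem_image.1 (Finset.orderEmbOfFin_mem _ hcard i)
  choose g hg hgk using he
  let p : ℕ → Pt := fun i => if h : 0 < i ∧ i < P.card then g ⟨i - 1, by omega⟩ else o
  have hp0 : p 0 = o := by simp [p]
  have hpi : ∀ i, 0 < i → i < P.card → p i ∈ P.erase o := by
    intro i h1 h2
    simp only [p, dif_pos (And.intro h1 h2)]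
    exact hg _
  have hlt : ∀ i j, 0 < i → i < j → j < P.card → key (p i) < key (p j) := by
    intro i j h1 h2 h3
    simp only [p, dif_pos (And.intro h1 (h2.trans h3)), dif_pos (And.intro (h1.trans h2) h3)]
    rw [hgk, hgk]
    apply e.strictMono
    rw [Fin.mk_lt_mk]; omega
  have hne' : ∀ i j, i < j → j < P.card → p i ≠ p j := by
    intro i j hij hj h
    rcases Nat.eq_zero_or_pos i with h0 | h0
    · subst h0
      have := hpi j hij hj
      rw [← h, hp0] at this
      simp at this
    · have := hlt i j h0 hij hj
      rw [h] at this
      exact lt_irrefl _ this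
  have hPi : ∀ i < P.card, p i ∈ P := by
    intro i hi
    rcases Nat.eq_zero_or_pos i with h0 | h0
    · rw [h0, hp0]; exact hoP
    · exact Finset.mem_of_mem_erase (hpi i h0 hi)
  refine ⟨p, hPi, ?_, ?_, ?_⟩
  · intro i hi j hj h
    rcases lt_trichotomy i j with h' | h' | h'
    · exact absurd h (hne' i j h' hj)
    · exact h'
    · exact absurd h.symm (hne' j i h' hi)
  · intro i j k hij hjk hk
    have hj := hpi j (by omega) (by omega)
    have hk' := hpi k (by omega) (by omega)
    have r2 := hkey _ hj _ hk' (hlt j k (by omega) hjk hk)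
    rcases Nat.eq_zero_or_pos i with h0 | h0
    · subst h0
      rw [hp0]
      rcases r2 with h | ⟨h, -⟩
      · exact h.le
      · exact h.ge
    · have hi := hpi i h0 (by omega)
      have r1 := hkey _ hi _ hj (hlt i j h0 hij (by omega))
      refine three ?_ ?_ (hf _ hi) r1 r2
      · rintro x (rfl | rfl | rfl | rfl)
        · exact hX _ hfP
        · exact hX _ hi
        · exact hX _ hj
        · exact hX _ hk'
      · obtain ⟨α, β, h1, h2⟩ := hsup _ (hPi j (by omega))
        refine ⟨α, β, h1, ?_⟩
        rintro x (rfl | rfl | rfl | rfl)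
        · exact h2 _ hoP
        · exact h2 _ (Finset.mem_of_mem_erase hfP)
        · exact h2 _ (hPi i (by omega))
        · exact h2 _ (hPi k (by omega))
  · rintro i hi j hj hi0 hj0 ⟨c, hc0, hc1, e0, e1⟩
    have h1 := hX _ (hpi i (by omega) hi)
    have h2 := hX _ (hpi j (by omega) hj)
    rw [hp0] at e0 e1
    have : (1 - c) * (A * (p i 0 - o 0) + B * (p i 1 - o 1)) +
        c * (A * (p j 0 - o 0) + B * (p j 1 - o 1)) = 0 := by
      linear_combination (-A) * e0 - B * e1
    have a1 := mul_pos (show 0 < 1 - c by linarith) h1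
    have a2 := mul_pos hc0 h2
    linarith

theorem stmt5 (l k : ℕ) (hl : 3 ≤ l) (hk : 3 ≤ k) (hodd : Odd k)
    (P : Finset Pt) (hconv : ConvexPos P)
    (hcard : (l - 1) * (k - 1) / 2 + 1 ≤ P.card) :
    HasCollinear P l ∨ HasStrictConvex P k := by
  obtain ⟨m, rfl⟩ := hodd
  have hm : 1 ≤ m := by omega
  have h2 : (l - 1) * (2 * m + 1 - 1) / 2 = (l - 1) * m := by
    rw [Nat.add_sub_cancel, show (l - 1) * (2 * m) = ((l - 1) * m) * 2 by ring]
    exact Nat.mul_div_cancel _ (by norm_num)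
  rw [h2] at hcard
  have hlm : l - 1 ≤ (l - 1) * m := Nat.le_mul_of_pos_right _ (by omega)
  by_cases hnc : Collinear ℝ (P : Set Pt)
  · left
    obtain ⟨S, hS, hSc⟩ := Finset.exists_subset_card_eq (show l ≤ P.card by omega)
    exact ⟨S, hS, hSc, hnc.subset (by exact_mod_cast hS)⟩
  · have hne : P.Nonempty := by
      rw [← Finset.card_pos]; omega
    obtain ⟨p, h1, h2, h3, h4⟩ := enum P hne (support P hconv hnc)
    exact select P l m hl hm P.card hcard p h1 h2 h3 h4
end

section
/- For all integers ℓ ≥ 3 and odd k ≥ 3, ES(k,ℓ) ≤ ES((k−1)(ℓ−1)/2 + 1); that is, every finite set of at least ES((k−1)(ℓ−1)/2 + 1) points in the plane contains ℓ collinear points or k points in strictly convex position. -/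
open scoped RealInnerProductSpace

namespace ESK

/-- Orientation determinant. -/
def D (a b c : Pt) : ℝ := (b 0 - a 0) * (c 1 - a 1) - (b 1 - a 1) * (c 0 - a 0)

/-- Three distinct collinear points. -/
def col (a b c : Pt) : Prop := a ≠ b ∧ b ≠ c ∧ a ≠ c ∧ D a b c = 0

lemma D_rot (a b c : Pt) : D b c a = D a b c := by unfold D; ring
lemma D_swap (a b c : Pt) : D b a c = - D a b c := by unfold D; ring

lemma col_rot {a b c : Pt} (h : col a b c) : col b c a := by
  obtain ⟨h1, h2, h3, h4⟩ := h
  exact ⟨h2, h3.symm, h1.symm, by rw [D_rot]; exact h4⟩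

lemma col_swap {a b c : Pt} (h : col a b c) : col b a c := by
  obtain ⟨h1, h2, h3, h4⟩ := h
  exact ⟨h1.symm, h3, h2, by rw [D_swap, h4, neg_zero]⟩

lemma pt_ext {a b : Pt} (h0 : a 0 = b 0) (h1 : a 1 = b 1) : a = b := by
  ext i; fin_cases i <;> simpa

lemma inner_eq (v x : Pt) : ⟪v, x⟫ = v 0 * x 0 + v 1 * x 1 := by
  rw [PiLp.inner_apply, Fin.sum_univ_two]; simp [mul_comm]

/-- if `p ≠ q`, points on the line -/
lemma exists_param {p q x : Pt} (hpq : p ≠ q) (h : D p q x = 0) :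
    ∃ r : ℝ, x = r • (q - p) + p := by
  unfold D at h
  by_cases h0 : q 0 - p 0 = 0
  · have h1 : q 1 - p 1 ≠ 0 := by
      intro h1
      exact hpq (pt_ext (by linarith) (by linarith))
    have hx : x 0 - p 0 = 0 := by
      rw [h0] at h
      have : (q 1 - p 1) * (x 0 - p 0) = 0 := by linarith
      exact (mul_eq_zero.1 this).resolve_left h1
    refine ⟨(x 1 - p 1) / (q 1 - p 1), pt_ext ?_ ?_⟩
    · simp [h0]; linarith
    · simp [div_mul_cancel₀ _ h1]
  · refine ⟨(x 0 - p 0) / (q 0 - p 0), pt_ext ?_ ?_⟩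
    · simp [div_mul_cancel₀ _ h0]
    · simp; field_simp; linarith

lemma collinear_line {p q : Pt} (hpq : p ≠ q) (S : Set Pt) (h : ∀ x ∈ S, D p q x = 0) :
    Collinear ℝ S := by
  rw [collinear_iff_exists_forall_eq_smul_vadd]
  refine ⟨p, q - p, fun x hx => ?_⟩
  obtain ⟨r, hr⟩ := exists_param hpq (h x hx)
  exact ⟨r, by simpa using hr⟩

lemma D_of_collinear {a b c : Pt} (h : Collinear ℝ ({a, b, c} : Set Pt)) : D a b c = 0 := by
  rw [collinear_iff_exists_forall_eq_smul_vadd] at h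
  obtain ⟨p, v, h⟩ := h
  obtain ⟨r, hr⟩ := h a (by simp)
  obtain ⟨s, hs⟩ := h b (by simp)
  obtain ⟨t, ht⟩ := h c (by simp)
  rw [hr, hs, ht]; unfold D; simp; ring

lemma collinear_of_D {a b c : Pt} (hab : a ≠ b) (h : D a b c = 0) :
    Collinear ℝ ({a, b, c} : Set Pt) := by
  apply collinear_line hab
  intro x hx
  simp only [Set.mem_insert_iff, Set.mem_singleton_iff] at hx
  rcases hx with rfl | rfl | rfl
  · unfold D; ring
  · unfold D; ring
  · exact h

/-- No three collinear. -/
def NoCol (P : Finset Pt) : Prop := ∀ a ∈ P, ∀ b ∈ P, ∀ c ∈ P, ¬ col a b c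

lemma genPos_iff (P : Finset Pt) : GenPos P ↔ NoCol P := by
  constructor
  · intro h a ha b hb c hc hcol
    obtain ⟨h1, h2, h3, h4⟩ := hcol
    refine h {a, b, c} ?_ (Finset.card_eq_three.2 ⟨a, b, c, h1, h3, h2, rfl⟩) ?_
    · intro x hx; simp at hx; rcases hx with rfl | rfl | rfl <;> assumption
    · simpa using collinear_of_D h1 h4
  · intro h S hS hc hcol
    obtain ⟨a, b, c, h1, h3, h2, rfl⟩ := Finset.card_eq_three.1 hc
    refine h a (hS (by simp)) b (hS (by simp)) c (hS (by simp)) ⟨h1, h2, h3, ?_⟩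
    exact D_of_collinear (by simpa using hcol)

/-- Weakly convex: a supporting functional at each point. -/
def W (S : Finset Pt) : Prop :=
  ∀ p ∈ S, ∃ v : Pt, v ≠ 0 ∧ ∀ y ∈ S, ⟪v, y⟫ ≤ ⟪v, p⟫

lemma W.mono {S T : Finset Pt} (h : W S) (hT : T ⊆ S) : W T := fun p hp => by
  obtain ⟨v, hv, h⟩ := h p (hT hp)
  exact ⟨v, hv, fun y hy => h y (hT hy)⟩

/-- Points on a common level line are collinear. -/
lemma D_of_level {v a b c : Pt} (hv : v ≠ 0) (hab : ⟪v, a⟫ = ⟪v, b⟫) (hac : ⟪v, a⟫ = ⟪v, c⟫) :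
    D a b c = 0 := by
  simp only [inner_eq] at *
  unfold D
  by_cases h0 : v 0 = 0
  · have h1 : v 1 ≠ 0 := fun h1 => hv (pt_ext (by simpa using h0) (by simpa using h1))
    apply mul_left_cancel₀ h1
    rw [h0] at hab hac
    linear_combination (c 0 - a 0) * hab - (b 0 - a 0) * hac
  · apply mul_left_cancel₀ h0
    linear_combination -(c 1 - a 1) * hab + (b 1 - a 1) * hac

def mid (S : Finset Pt) (m : Pt) : Prop :=
  m ∈ S ∧ ∃ a ∈ S, ∃ b ∈ S, Sbtw ℝ a m b

lemma sbtw_level {a m b v : Pt} (h : Sbtw ℝ a m b) (ha : ⟪v, a⟫ ≤ ⟪v, m⟫) (hb : ⟪v, b⟫ ≤ ⟪v, m⟫) :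
    ⟪v, m⟫ = ⟪v, a⟫ ∧ ⟪v, m⟫ = ⟪v, b⟫ := by
  rw [sbtw_iff_mem_image_Ioo_and_ne] at h
  obtain ⟨⟨t, ⟨h0, h1⟩, rfl⟩, _⟩ := h
  simp only [inner_eq, AffineMap.lineMap_apply] at *
  simp at *
  constructor <;> nlinarith

lemma sbtw_col {a m b : Pt} (h : Sbtw ℝ a m b) : col a m b :=
  ⟨h.left_ne, h.ne_right, h.left_ne_right, D_of_collinear h.wbtw.collinear⟩

lemma F1 {S : Finset Pt} {a b c : Pt} (ha : a ∈ S) (hb : b ∈ S) (hc : c ∈ S) (h : col a b c) :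
    mid S a ∨ mid S b ∨ mid S c := by
  obtain ⟨h1, h2, h3, h4⟩ := h
  rcases (collinear_of_D h1 h4).wbtw_or_wbtw_or_wbtw with h | h | h
  · exact Or.inr (Or.inl ⟨hb, a, ha, c, hc, h, h1.symm, h2⟩)
  · exact Or.inr (Or.inr ⟨hc, b, hb, a, ha, h, h2.symm, h3.symm⟩)
  · exact Or.inl ⟨ha, c, hc, b, hb, h, h3, h1⟩

/-- a functional containing the collinear triple on its top level -/
lemma top_triple {S : Finset Pt} (hW : W S) {a b c : Pt} (ha : a ∈ S) (hb : b ∈ S) (hc : c ∈ S)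
    (h : col a b c) : ∃ v : Pt, v ≠ 0 ∧ (∀ y ∈ S, ⟪v, y⟫ ≤ ⟪v, a⟫) ∧ ⟪v, a⟫ = ⟪v, b⟫ ∧
      ⟪v, a⟫ = ⟪v, c⟫ := by
  obtain ⟨h1, h2, h3, h4⟩ := h
  rcases (collinear_of_D h1 h4).wbtw_or_wbtw_or_wbtw with h | h | h
  · obtain ⟨v, hv, hm⟩ := hW b hb
    obtain ⟨e1, e2⟩ := sbtw_level ⟨h, h1.symm, h2⟩ (hm a ha) (hm c hc)
    exact ⟨v, hv, fun y hy => e1 ▸ hm y hy, e1.symm, by rw [← e1, e2]⟩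
  · obtain ⟨v, hv, hm⟩ := hW c hc
    obtain ⟨e1, e2⟩ := sbtw_level ⟨h, h2.symm, h3.symm⟩ (hm b hb) (hm a ha)
    exact ⟨v, hv, fun y hy => e2 ▸ hm y hy, by rw [← e1, e2], e2.symm⟩
  · obtain ⟨v, hv, hm⟩ := hW a ha
    obtain ⟨e1, e2⟩ := sbtw_level ⟨h, h3, h1⟩ (hm c hc) (hm b hb)
    exact ⟨v, hv, hm, e2, e1⟩

lemma F2' {S : Finset Pt} (hW : W S) {m x y : Pt} (hm : mid S m) (hx : x ∈ S) (hy : y ∈ S)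
    (h : col m x y) : ∃ a b, Sbtw ℝ a m b ∧ D a b x = 0 := by
  obtain ⟨hmS, a, ha, b, hb, hs⟩ := hm
  obtain ⟨v, hv, ht, e1, e2⟩ := top_triple hW hmS hx hy h
  obtain ⟨e3, e4⟩ := sbtw_level hs (ht a ha) (ht b hb)
  exact ⟨a, b, hs, D_of_level hv (by rw [← e3, e4]) (by rw [← e3, e1])⟩

lemma F2 {S : Finset Pt} (hW : W S) {m x y z w : Pt} (hm : mid S m) (hx : x ∈ S) (hy : y ∈ S)
    (hz : z ∈ S) (hw : w ∈ S)
    (h : col m x y) (h' : col m z w) : D m x z = 0 := by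
  obtain ⟨hmS, a, ha, b, hb, hs⟩ := hm
  obtain ⟨v, hv, ht, e1, e2⟩ := top_triple hW hmS hx hy h
  obtain ⟨e3, e4⟩ := sbtw_level hs (ht a ha) (ht b hb)
  obtain ⟨v', hv', ht', e1', e2'⟩ := top_triple hW hmS hz hw h'
  obtain ⟨e3', e4'⟩ := sbtw_level hs (ht' a ha) (ht' b hb)
  have hx : D m a x = 0 := D_of_level hv e3 e1
  have hz : D m a z = 0 := D_of_level hv' e3' e1'
  obtain ⟨r, rfl⟩ := exists_param hs.ne_left hx
  obtain ⟨s, rfl⟩ := exists_param hs.ne_left hz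
  unfold D; simp; ring

lemma extend {S R T : Finset Pt} {p q : Pt} (hp : p ∈ R) (hq : q ∈ R) (hpq : p ≠ q)
    (hR : R ⊆ S) (hT : T ⊆ S \ R) (hTc : NoCol T)
    (h1 : ∀ x ∈ S, ∀ y ∈ S, col p x y → (x ∈ R ∧ x ≠ q) ∨ (y ∈ R ∧ y ≠ q))
    (h2 : ∀ x ∈ S, ∀ y ∈ S, col q x y → (x ∈ R ∧ x ≠ p) ∨ (y ∈ R ∧ y ≠ p)) :
    ∃ T' ⊆ S, T'.card = T.card + 2 ∧ NoCol T' := by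
  have hTS : ∀ x ∈ T, x ∈ S ∧ x ∉ R := fun x hx => by simpa using hT hx
  have hpT : p ∉ T := fun h => (hTS p h).2 hp
  have hqT : q ∉ T := fun h => (hTS q h).2 hq
  have hsub : insert p (insert q T) ⊆ S := by
    intro x hx; simp at hx
    rcases hx with rfl | rfl | hx
    exacts [hR hp, hR hq, (hTS x hx).1]
  have key : ∀ x ∈ insert p (insert q T), x ∈ R → x = p ∨ x = q := by
    intro x hx hxR; simp at hx
    rcases hx with rfl | rfl | hx
    exacts [Or.inl rfl, Or.inr rfl, absurd hxR (hTS x hx).2]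
  have kp : ∀ x ∈ insert p (insert q T), ∀ y ∈ insert p (insert q T), ¬ col p x y := by
    intro x hx y hy hc
    rcases h1 x (hsub hx) y (hsub hy) hc with h | h
    · rcases key x hx h.1 with h' | h'
      exacts [hc.1 h'.symm, h.2 h']
    · rcases key y hy h.1 with h' | h'
      exacts [hc.2.2.1 h'.symm, h.2 h']
  have kq : ∀ x ∈ insert p (insert q T), ∀ y ∈ insert p (insert q T), ¬ col q x y := by
    intro x hx y hy hc
    rcases h2 x (hsub hx) y (hsub hy) hc with h | h
    · rcases key x hx h.1 with h' | h'
      exacts [h.2 h', hc.1 h'.symm]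
    · rcases key y hy h.1 with h' | h'
      exacts [h.2 h', hc.2.2.1 h'.symm]
  have kpq : ∀ z, z = p ∨ z = q → ∀ x ∈ insert p (insert q T), ∀ y ∈ insert p (insert q T),
      ¬ col z x y := by
    rintro z (rfl | rfl)
    exacts [kp, kq]
  refine ⟨insert p (insert q T), hsub, ?_, ?_⟩
  · rw [Finset.card_insert_of_notMem (by simp [hpq, hpT]), Finset.card_insert_of_notMem hqT]
  · intro a ha b hb c hc hcol
    have hd : ∀ x ∈ insert p (insert q T), (x = p ∨ x = q) ∨ x ∈ T := by
      intro x hx; simp at hx; tauto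
    rcases hd a ha with h | h
    · exact kpq a h b hb c hc hcol
    rcases hd b hb with h' | h'
    · exact kpq b h' c hc a ha (col_rot hcol)
    rcases hd c hc with h'' | h''
    · exact kpq c h'' a ha b hb (col_rot (col_rot hcol))
    exact hTc a h b h' c h'' hcol

/-- Removal step. -/
lemma step {S : Finset Pt} (hW : W S) {l : ℕ} (hl : ¬ HasCollinear S l) (hl3 : 3 ≤ l)
    (hS : ¬ NoCol S) : ∃ R ⊆ S, R.card ≤ l - 1 ∧ ∃ p ∈ R, ∃ q ∈ R, p ≠ q ∧
    (∀ x ∈ S, ∀ y ∈ S, col p x y → (x ∈ R ∧ x ≠ q) ∨ (y ∈ R ∧ y ≠ q)) ∧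
    (∀ x ∈ S, ∀ y ∈ S, col q x y → (x ∈ R ∧ x ≠ p) ∨ (y ∈ R ∧ y ≠ p)) := by
  have hline : ∀ p q : Pt, p ≠ q → (S.filter fun x => D p q x = 0).card ≤ l - 1 := by
    intro p q hpq
    by_contra hc
    obtain ⟨U, hU, hUc⟩ := Finset.exists_subset_card_eq
      (show l ≤ (S.filter fun x => D p q x = 0).card by omega)
    refine hl ⟨U, hU.trans (Finset.filter_subset _ _), hUc, collinear_line hpq _ ?_⟩
    intro x hx
    exact (Finset.mem_filter.1 (hU hx)).2
  by_cases hB1 : ∃ p q r, mid S p ∧ mid S q ∧ r ∈ S ∧ col p q r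
  · obtain ⟨p, q, r, hp, hq, hr, hcol⟩ := hB1
    refine ⟨S.filter fun x => D p q x = 0, Finset.filter_subset _ _, hline p q hcol.1, p, ?_, q, ?_,
      hcol.1, ?_, ?_⟩
    · exact Finset.mem_filter.2 ⟨hp.1, by unfold D; ring⟩
    · exact Finset.mem_filter.2 ⟨hq.1, by unfold D; ring⟩
    · intro x hx y hy hc
      by_cases hxq : x = q
      · right
        refine ⟨Finset.mem_filter.2 ⟨hy, hxq ▸ hc.2.2.2⟩, ?_⟩
        rintro rfl; exact hc.2.1 hxq
      · left
        exact ⟨Finset.mem_filter.2 ⟨hx, F2 hW hp hq.1 hr hx hy hcol hc⟩, hxq⟩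
    · intro x hx y hy hc
      have h0 : ∀ z, D q p z = 0 → D p q z = 0 := fun z hz => by rw [D_swap, hz, neg_zero]
      by_cases hxq : x = p
      · right
        refine ⟨Finset.mem_filter.2 ⟨hy, h0 _ (hxq ▸ hc.2.2.2)⟩, ?_⟩
        rintro rfl; exact hc.2.1 hxq
      · left
        exact ⟨Finset.mem_filter.2 ⟨hx, h0 _ (F2 hW hq hp.1 hr hx hy (col_swap hcol) hc)⟩, hxq⟩
  push Not at hB1
  have hmid : ∃ a ∈ S, ∃ m, ∃ b ∈ S, mid S m ∧ col m a b := by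
    unfold NoCol at hS
    push Not at hS
    obtain ⟨a, ha, b, hb, c, hc, hcol⟩ := hS
    rcases F1 ha hb hc hcol with h | h | h
    · exact ⟨b, hb, a, c, hc, h, hcol⟩
    · exact ⟨a, ha, b, c, hc, h, col_swap hcol⟩
    · exact ⟨a, ha, c, b, hb, h, col_rot (col_rot hcol)⟩
  -- a mid lies on only one triple
  have hone : ∀ m a b, mid S m → a ∈ S → b ∈ S → col m a b → ∀ x ∈ S, ∀ y ∈ S, col m x y →
      x = a ∨ x = b := by
    intro m a b hm ha hb hcol x hx y hy hc
    by_contra hne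
    push Not at hne
    have e1 := F2 hW hm ha hb hx hy hcol hc
    have e2 := F2 hW hm hb ha hx hy (col_swap (col_rot (col_rot hcol))) hc
    have cmax : col m a x := ⟨hcol.1, hne.1.symm, hc.1, e1⟩
    have cabx : col a b x := by
      refine ⟨hcol.2.1, hne.2.symm, hne.1.symm, ?_⟩
      have : D m a b = 0 := hcol.2.2.2
      have e : D a b x = D m a b - D m a x + D m b x := by unfold D; ring
      rw [e, this, e1, e2]; ring
    rcases F1 ha hb hx cabx with h | h | h
    · exact hB1 m a b hm h hb hcol
    · exact hB1 m b a hm h ha (col_swap (col_rot (col_rot hcol)))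
    · exact hB1 m x a hm h ha (col_swap (col_rot (col_rot cmax)))
  have hboth : ∀ m a b, mid S m → a ∈ S → b ∈ S → col m a b → ∀ x ∈ S, ∀ y ∈ S, col m x y →
      x = a ∨ y = a := by
    intro m a b hm ha hb hcol x hx y hy hc
    rcases hone m a b hm ha hb hcol x hx y hy hc with h | h
    · exact Or.inl h
    rcases hone m a b hm ha hb hcol y hy x hx (col_swap (col_rot (col_rot hc))) with h' | h'
    · exact Or.inr h'
    · exact absurd (h.trans h'.symm) hc.2.1
  obtain ⟨a, ha, m, b, hb, hm, hcol⟩ := hmid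
  have h3 : 3 ≤ l - 1 := by
    by_contra h
    have : l = 3 := by omega
    subst this
    refine hl ⟨{m, a, b}, ?_, Finset.card_eq_three.2 ⟨m, a, b, hcol.1, hcol.2.2.1, hcol.2.1, rfl⟩, ?_⟩
    · intro x hx; simp at hx; rcases hx with rfl | rfl | rfl
      exacts [hm.1, ha, hb]
    · simpa using collinear_of_D hcol.1 hcol.2.2.2
  have hcard : ∀ x y z : Pt, ({x, y, z} : Finset Pt).card ≤ l - 1 := fun x y z =>
    Finset.card_le_three.trans h3
  by_cases hB2 : ∃ m a b m' d, mid S m ∧ mid S m' ∧ m ≠ m' ∧ a ∈ S ∧ b ∈ S ∧ d ∈ S ∧ col m a b ∧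
      col m' a d
  · obtain ⟨m, a, b, m', d, hm, hm', hmm, ha, hb, hd, c1, c2⟩ := hB2
    refine ⟨{m, a, m'}, ?_, hcard _ _ _, m, by simp, m', by simp, hmm, ?_, ?_⟩
    · intro x hx; simp at hx; rcases hx with rfl | rfl | rfl
      exacts [hm.1, ha, hm'.1]
    · intro x hx y hy hc
      rcases hboth m a b hm ha hb c1 x hx y hy hc with rfl | rfl
      · exact Or.inl ⟨by simp, c2.1.symm⟩
      · exact Or.inr ⟨by simp, c2.1.symm⟩
    · intro x hx y hy hc
      rcases hboth m' a d hm' ha hd c2 x hx y hy hc with rfl | rfl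
      · exact Or.inl ⟨by simp, c1.1.symm⟩
      · exact Or.inr ⟨by simp, c1.1.symm⟩
  · have hend : ∀ a b, a ∈ S → b ∈ S → col m a b → ∀ x ∈ S, ∀ y ∈ S, col a x y →
        x = m ∨ y = m := by
      intro a b ha hb hcol x hx y hy hc
      by_contra hne
      push Not at hne
      rcases F1 ha hx hy hc with h | h | h
      · exact hB1 m a b hm h hb hcol
      · exact hB2 ⟨m, a, b, x, y, hm, h, hne.1.symm, ha, hb, hy, hcol, col_swap hc⟩
      · exact hB2 ⟨m, a, b, y, x, hm, h, hne.2.symm, ha, hb, hx, hcol, col_rot (col_rot hc)⟩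
    refine ⟨{a, m, b}, ?_, hcard _ _ _, a, by simp, b, by simp, hcol.2.1, ?_, ?_⟩
    · intro x hx; simp at hx; rcases hx with rfl | rfl | rfl
      exacts [ha, hm.1, hb]
    · intro x hx y hy hc
      rcases hend a b ha hb hcol x hx y hy hc with rfl | rfl
      · exact Or.inl ⟨by simp, hcol.2.2.1⟩
      · exact Or.inr ⟨by simp, hcol.2.2.1⟩
    · intro x hx y hy hc
      rcases hend b a hb ha (col_swap (col_rot (col_rot hcol))) x hx y hy hc with rfl | rfl
      · exact Or.inl ⟨by simp, hcol.1⟩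
      · exact Or.inr ⟨by simp, hcol.1⟩

lemma main_ind (l : ℕ) (hl3 : 3 ≤ l) (j : ℕ) : ∀ S : Finset Pt, W S → ¬ HasCollinear S l →
    j * (l - 1) + 1 ≤ S.card → ∃ T ⊆ S, T.card = 2 * j + 1 ∧ NoCol T := by
  induction j with
  | zero =>
    intro S _ _ hc
    obtain ⟨T, hT, hTc⟩ := Finset.exists_subset_card_eq (show 1 ≤ S.card by omega)
    refine ⟨T, hT, by simpa using hTc, ?_⟩
    obtain ⟨x, rfl⟩ := Finset.card_eq_one.1 hTc
    intro a ha b hb c _ h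
    simp at ha hb
    exact h.1 (ha.trans hb.symm)
  | succ j ih =>
    intro S hW hcl hc
    by_cases hS : NoCol S
    · have : 2 * (j + 1) + 1 ≤ S.card := by
        have : (j + 1) * 2 ≤ (j + 1) * (l - 1) := Nat.mul_le_mul_left _ (by omega)
        omega
      obtain ⟨T, hT, hTc⟩ := Finset.exists_subset_card_eq this
      exact ⟨T, hT, hTc, fun a ha b hb c hc => hS a (hT ha) b (hT hb) c (hT hc)⟩
    · obtain ⟨R, hR, hRc, p, hp, q, hq, hpq, h1, h2⟩ := step hW hcl hl3 hS
      obtain ⟨T, hT, hTc, hTn⟩ := ih (S \ R) (hW.mono Finset.sdiff_subset)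
        (fun ⟨U, hU, h⟩ => hcl ⟨U, hU.trans Finset.sdiff_subset, h⟩) (by
          rw [Finset.card_sdiff_of_subset hR]
          rw [add_mul] at hc
          omega)
      obtain ⟨T', hT', hc', hn'⟩ := extend hp hq hpq hR hT hTn h1 h2
      exact ⟨T', hT', by omega, hn'⟩

lemma strict_of {T : Finset Pt} (hW : W T) (hT : NoCol T) : StrictConvexPos T := by
  intro v hv heq
  obtain ⟨u, hu, hmax⟩ := hW v hv
  have hw : ∃ w : Pt, ∀ y ∈ T, y ≠ v → ⟪u, y⟫ = ⟪u, v⟫ → ⟪w, y⟫ < ⟪w, v⟫ := by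
    by_cases h : ∃ y ∈ T, y ≠ v ∧ ⟪u, y⟫ = ⟪u, v⟫
    · obtain ⟨y, hy, hyv, e⟩ := h
      refine ⟨v - y, fun z hz hzv e' => ?_⟩
      have : z = y := by
        by_contra hne
        exact hT v hv z hz y hy ⟨hzv.symm, hne, hyv.symm, D_of_level hu e'.symm e.symm⟩
      subst this
      have : 0 < ⟪v - z, v - z⟫ := by
        rw [real_inner_self_eq_norm_sq]
        have : 0 < ‖v - z‖ := norm_pos_iff.2 (sub_ne_zero.2 hyv.symm)
        positivity
      rw [inner_sub_right] at this
      linarith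
    · push Not at h
      exact ⟨0, fun y hy hyv e => absurd e (h y hy hyv)⟩
  obtain ⟨w, hw⟩ := hw
  have hconv : Convex ℝ {x : Pt | ⟪u, x⟫ < ⟪u, v⟫ ∨ (⟪u, x⟫ = ⟪u, v⟫ ∧ ⟪w, x⟫ < ⟪w, v⟫)} := by
    rw [convex_iff_forall_pos]
    intro x hx y hy a b ha hb hab
    simp only [Set.mem_ofPred_eq, inner_add_right, inner_smul_right] at *
    have e1 : ⟪u, v⟫ = a * ⟪u, v⟫ + b * ⟪u, v⟫ := by rw [← add_mul, hab, one_mul]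
    have e2 : ⟪w, v⟫ = a * ⟪w, v⟫ + b * ⟪w, v⟫ := by rw [← add_mul, hab, one_mul]
    rcases hx with hx | ⟨hx, hx'⟩ <;> rcases hy with hy | ⟨hy, hy'⟩
    · left
      nlinarith [mul_lt_mul_of_pos_left hx ha, mul_lt_mul_of_pos_left hy hb]
    · left; rw [hy]
      nlinarith [mul_lt_mul_of_pos_left hx ha]
    · left; rw [hx]
      nlinarith [mul_lt_mul_of_pos_left hy hb]
    · right; rw [hx, hy]
      refine ⟨e1.symm, ?_⟩
      nlinarith [mul_lt_mul_of_pos_left hx' ha, mul_lt_mul_of_pos_left hy' hb]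
  have hin : v ∈ convexHull ℝ ((T : Set Pt) \ {v}) := by
    rw [heq]; exact subset_convexHull ℝ _ hv
  have := convexHull_min (t := {x : Pt | ⟪u, x⟫ < ⟪u, v⟫ ∨ (⟪u, x⟫ = ⟪u, v⟫ ∧ ⟪w, x⟫ < ⟪w, v⟫)})
    (by
      rintro y ⟨hy, hyv⟩
      rcases (hmax y hy).lt_or_eq with h | h
      · exact Or.inl h
      · exact Or.inr ⟨h, hw y hy hyv h⟩) hconv hin
  rcases this with h | h
  · exact lt_irrefl _ h
  · exact lt_irrefl _ h.2

lemma frontier_of_support {S : Finset Pt} {p v : Pt} (hp : p ∈ S) (hv : v ≠ 0)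
    (h : ∀ y ∈ S, ⟪v, y⟫ ≤ ⟪v, p⟫) : p ∈ frontier (convexHull ℝ (S : Set Pt)) := by
  refine ⟨subset_closure (subset_convexHull ℝ _ hp), fun hint => ?_⟩
  have hsub : convexHull ℝ (S : Set Pt) ⊆ {x | ⟪v, x⟫ ≤ ⟪v, p⟫} := by
    refine convexHull_min (fun y hy => h y hy) ?_
    intro x hx y hy a b ha hb hab
    simp only [Set.mem_ofPred_eq, inner_add_right, inner_smul_right] at *
    have e1 : ⟪v, p⟫ = a * ⟪v, p⟫ + b * ⟪v, p⟫ := by rw [← add_mul, hab, one_mul]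
    nlinarith [mul_le_mul_of_nonneg_left hx ha, mul_le_mul_of_nonneg_left hy hb]
  have hn := mem_interior_iff_mem_nhds.1 hint
  have hc : Filter.Tendsto (fun t : ℝ => p + t • v) (nhds 0) (nhds p) := by
    have : Continuous (fun t : ℝ => p + t • v) := by fun_prop
    simpa using this.tendsto 0
  have he : ∀ᶠ t in nhdsWithin (0:ℝ) (Set.Ioi 0), p + t • v ∈ convexHull ℝ (S : Set Pt) :=
    (hc.eventually hn).filter_mono nhdsWithin_le_nhds
  obtain ⟨t, ht, ht0⟩ := (he.and self_mem_nhdsWithin).exists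
  have := hsub ht
  simp only [Set.mem_ofPred_eq, inner_add_right, inner_smul_right,
    real_inner_self_eq_norm_sq] at this
  have h1 : 0 < ‖v‖ := norm_pos_iff.2 hv
  have h2 : 0 < t * ‖v‖ ^ 2 := mul_pos ht0 (by positivity)
  linarith

/-- height function -/
def H (α β : ℝ) (p : Pt) : ℝ := α * p 0 + β * p 1

def Cup (α β : ℝ) (C : Finset Pt) : Prop :=
  ∀ a ∈ C, ∀ b ∈ C, ∀ c ∈ C, H α β a < H α β b → H α β b < H α β c → 0 < D a b c

lemma H_neg (α β : ℝ) (p : Pt) : H (-α) (-β) p = - H α β p := by unfold H; ring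

lemma trans1 {α β : ℝ} {a b c d : Pt} (h1 : H α β a < H α β b) (h2 : H α β b < H α β c)
    (h3 : H α β c < H α β d) (e1 : 0 < D a b c) (e2 : 0 < D b c d) : 0 < D a b d := by
  have e : (H α β c - H α β b) * D a b d =
      (H α β d - H α β b) * D a b c + (H α β b - H α β a) * D b c d := by
    unfold H D; ring
  have : 0 < (H α β c - H α β b) * D a b d := by
    rw [e]
    have := mul_pos (show 0 < H α β d - H α β b by linarith) e1
    have := mul_pos (show 0 < H α β b - H α β a by linarith) e2
    linarith
  exact pos_of_mul_pos_right this (by linarith)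

lemma trans2 {α β : ℝ} {a b c d : Pt} (h1 : H α β a < H α β b) (h2 : H α β b < H α β c)
    (h3 : H α β c < H α β d) (e1 : 0 < D a b c) (e2 : 0 < D b c d) : 0 < D a c d := by
  have e : (H α β c - H α β b) * D a c d =
      (H α β d - H α β c) * D a b c + (H α β c - H α β a) * D b c d := by
    unfold H D; ring
  have : 0 < (H α β c - H α β b) * D a c d := by
    rw [e]
    have := mul_pos (show 0 < H α β d - H α β c by linarith) e1
    have := mul_pos (show 0 < H α β c - H α β a by linarith) e2
    linarith
  exact pos_of_mul_pos_right this (by linarith)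

/-- Extend a cup to the right. -/
lemma cup_extend {α β : ℝ} {C : Finset Pt} (hC : Cup α β C) (hinj : Set.InjOn (H α β) C)
    {p x q : Pt} (hp : p ∈ C) (hx : x ∈ C)
    (hpx : H α β p < H α β x) (hxm : ∀ y ∈ C, H α β y ≤ H α β x)
    (hpm : ∀ y ∈ C, y ≠ x → H α β y ≤ H α β p) (hxq : H α β x < H α β q) (hD : 0 < D p x q) :
    Cup α β (insert q C) ∧ q ∉ C := by
  have hqC : q ∉ C := fun h => absurd (hxm q h) (by linarith)
  refine ⟨?_, hqC⟩
  have k1 : ∀ a ∈ C, H α β a < H α β x → 0 < D a x q := by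
    intro a ha hax
    by_cases hap : a = p
    · rw [hap]; exact hD
    · have h1 : H α β a ≤ H α β p := hpm a ha (by rintro rfl; exact lt_irrefl _ hax)
      have h2 : H α β a ≠ H α β p := fun e => hap (hinj ha hp e)
      have h3 := lt_of_le_of_ne h1 h2
      exact trans2 h3 hpx hxq (hC a ha p hp x hx h3 hpx) hD
  have k2 : ∀ a ∈ C, ∀ b ∈ C, H α β a < H α β b → 0 < D a b q := by
    intro a ha b hb hab
    by_cases hbx : b = x
    · rw [hbx] at hab ⊢; exact k1 a ha hab
    · have h3 := lt_of_le_of_ne (hxm b hb) fun e => hbx (hinj hb hx e)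
      exact trans1 hab h3 hxq (hC a ha b hb x hx hab h3) (k1 b hb h3)
  intro a ha b hb c hc hab hbc
  have hle : ∀ y ∈ insert q C, H α β y ≤ H α β q := by
    intro y hy
    rcases Finset.mem_insert.1 hy with rfl | hy
    · exact le_rfl
    · have := hxm y hy; linarith
  have hbC : b ∈ C := by
    rcases Finset.mem_insert.1 hb with rfl | h
    · exact absurd (hle c hc) (by linarith)
    · exact h
  have haC : a ∈ C := by
    rcases Finset.mem_insert.1 ha with rfl | h
    · exact absurd (hle b hb) (by linarith)
    · exact h
  rcases Finset.mem_insert.1 hc with rfl | hcC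
  · exact k2 a haC b hbC hab
  · exact hC a haC b hbC c hcC hab hbc

lemma cup_small {α β : ℝ} {C : Finset Pt} (hC : C.card ≤ 2) : Cup α β C := by
  intro a ha b hb c hc hab hbc
  exfalso
  have h1 : a ≠ b := by rintro rfl; exact lt_irrefl _ hab
  have h2 : b ≠ c := by rintro rfl; exact lt_irrefl _ hbc
  have h3 : a ≠ c := by rintro rfl; exact lt_irrefl _ (hab.trans hbc)
  have : ({a, b, c} : Finset Pt) ⊆ C := by
    intro x hx; simp at hx; rcases hx with rfl | rfl | rfl <;> assumption
  have := Finset.card_le_card this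
  rw [Finset.card_eq_three.2 ⟨a, b, c, h1, h3, h2, rfl⟩] at this
  omega

lemma exists_max_pred {α β : ℝ} {C : Finset Pt} (hinj : Set.InjOn (H α β) C)
    {x : Pt} (hx : x ∈ C) (hxm : ∀ y ∈ C, H α β y ≤ H α β x) (hc : 2 ≤ C.card) :
    ∃ p ∈ C, H α β p < H α β x ∧ ∀ y ∈ C, y ≠ x → H α β y ≤ H α β p := by
  have hne : (C.erase x).Nonempty := by
    rw [← Finset.card_pos, Finset.card_erase_of_mem hx]; omega
  obtain ⟨p, hp, hpm⟩ := Finset.exists_max_image (C.erase x) (H α β) hne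
  have hp' := Finset.mem_erase.1 hp
  refine ⟨p, hp'.2, lt_of_le_of_ne (hxm p hp'.2) fun e => hp'.1 (hinj hp'.2 hx e), ?_⟩
  intro y hy hyx
  exact hpm y (Finset.mem_erase.2 ⟨hyx, hy⟩)

lemma injOn_neg {α β : ℝ} {C : Set Pt} (hinj : Set.InjOn (H α β) C) :
    Set.InjOn (H (-α) (-β)) C := by
  intro a ha b hb e
  rw [H_neg, H_neg] at e
  exact hinj ha hb (neg_injective e)

lemma cupcap (k l : ℕ) : ∃ N : ℕ, ∀ (α β : ℝ) (P : Finset Pt), Set.InjOn (H α β) P → NoCol P →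
    N ≤ P.card → (∃ C ⊆ P, C.card = k + 2 ∧ Cup α β C) ∨
      (∃ C ⊆ P, C.card = l + 2 ∧ Cup (-α) (-β) C) := by
  induction k generalizing l with
  | zero =>
    refine ⟨2, fun α β P _ _ hc => Or.inl ?_⟩
    obtain ⟨C, hC, hCc⟩ := Finset.exists_subset_card_eq hc
    exact ⟨C, hC, hCc, cup_small hCc.le⟩
  | succ k ihk =>
    induction l with
    | zero =>
      refine ⟨2, fun α β P _ _ hc => Or.inr ?_⟩
      obtain ⟨C, hC, hCc⟩ := Finset.exists_subset_card_eq hc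
      exact ⟨C, hC, hCc, cup_small hCc.le⟩
    | succ l ihl =>
      obtain ⟨N1, h1⟩ := ihk (l + 1)
      obtain ⟨N2, h2⟩ := ihl
      refine ⟨N1 + N2, fun α β P hinj hP hc => ?_⟩
      classical
      set A := P.filter fun x => ∃ C ⊆ P, C.card = k + 2 ∧ Cup α β C ∧ x ∈ C ∧
        ∀ y ∈ C, H α β y ≤ H α β x with hA
      have hAP : A ⊆ P := Finset.filter_subset _ _
      have hcard : (P \ A).card + A.card = P.card := Finset.card_sdiff_add_card_eq_card hAP
      by_cases hN : N1 ≤ (P \ A).card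
      · have hs : P \ A ⊆ P := Finset.sdiff_subset
        rcases h1 α β (P \ A) (hinj.mono (by exact_mod_cast hs))
          (fun a ha b hb c hc => hP a (hs ha) b (hs hb) c (hs hc)) hN with ⟨C, hC, hCc, hcup⟩ | ⟨C, hC, hCc, hcup⟩
        · exfalso
          obtain ⟨x, hx, hxm⟩ := Finset.exists_max_image C (H α β)
            (by rw [← Finset.card_pos]; omega)
          refine (Finset.mem_sdiff.1 (hC hx)).2 (Finset.mem_filter.2 ⟨hs (hC hx), C, hC.trans hs,
            hCc, hcup, hx, hxm⟩)
        · exact Or.inr ⟨C, hC.trans hs, hCc, hcup⟩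
      · rcases h2 α β A (hinj.mono (by exact_mod_cast hAP))
          (fun a ha b hb c hc => hP a (hAP ha) b (hAP hb) c (hAP hc)) (by omega) with
          ⟨C, hC, hCc, hcup⟩ | ⟨E, hE, hEc, hcap⟩
        · exact Or.inl ⟨C, hC.trans hAP, hCc, hcup⟩
        · obtain ⟨x, hx, hxm⟩ := Finset.exists_max_image E (H (-α) (-β))
            (by rw [← Finset.card_pos]; omega)
          obtain ⟨hxP, C, hCP, hCc, hcup, hxC, hxCm⟩ := Finset.mem_filter.1 (hE hx)
          have hEP := hE.trans hAP
          have iC : Set.InjOn (H α β) C := hinj.mono (by exact_mod_cast hCP)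
          have iE : Set.InjOn (H (-α) (-β)) E := injOn_neg (hinj.mono (by exact_mod_cast hEP))
          obtain ⟨p, hp, hpx, hpm⟩ := exists_max_pred iC hxC hxCm (by omega)
          obtain ⟨q, hq, hqx, hqm⟩ := exists_max_pred iE hx hxm (by omega)
          have hxq : H α β x < H α β q := by rw [H_neg, H_neg] at hqx; linarith
          have hne : D p x q ≠ 0 := by
            intro h0
            refine hP p (hCP hp) x hxP q (hEP hq) ⟨?_, ?_, ?_, h0⟩
            · rintro rfl; exact lt_irrefl _ hpx
            · rintro rfl; exact lt_irrefl _ hxq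
            · rintro rfl; exact lt_irrefl _ (hpx.trans hxq)
          rcases lt_or_gt_of_ne hne with hneg | hpos
          · right
            have hD : 0 < D q x p := by
              have : D q x p = - D p x q := by unfold D; ring
              linarith
            have := cup_extend hcap iE hq hx hqx hxm hqm (q := p)
              (by rw [H_neg, H_neg]; linarith) hD
            refine ⟨insert p E, ?_, by rw [Finset.card_insert_of_notMem this.2]; omega, this.1⟩
            exact Finset.insert_subset (hCP hp) hEP
          · left
            have := cup_extend hcup iC hp hxC hpx hxCm hpm hxq hpos
            refine ⟨insert q C, ?_, by rw [Finset.card_insert_of_notMem this.2]; omega, this.1⟩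
            exact Finset.insert_subset (hEP hq) hCP

lemma support_of_D {C : Finset Pt} {p r s : Pt} (hpC : p ∈ C) (hqr : r ≠ s) (hp : p = r ∨ p = s)
    (h : ∀ x ∈ C, 0 ≤ D r s x) : p ∈ frontier (convexHull ℝ (C : Set Pt)) := by
  apply frontier_of_support (v := !₂[s 1 - r 1, -(s 0 - r 0)]) hpC
  · intro h0
    have h1 := congrArg (fun z : Pt => z 0) h0
    have h2 := congrArg (fun z : Pt => z 1) h0
    simp at h1 h2
    exact hqr (pt_ext (by linarith) (by linarith))
  · intro y hy
    have := h y hy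
    unfold D at this
    rcases hp with rfl | rfl <;> simp [inner_eq] <;> nlinarith

lemma cup_convex {α β : ℝ} {C : Finset Pt} (hC : Cup α β C) (hinj : Set.InjOn (H α β) C) :
    ConvexPos C := by
  intro p hp
  by_cases hmax : ∃ y ∈ C, H α β p < H α β y
  · obtain ⟨y, hy, hpy⟩ := hmax
    obtain ⟨q, hq, hqm⟩ := Finset.exists_min_image (C.filter fun y => H α β p < H α β y) (H α β)
      ⟨y, Finset.mem_filter.2 ⟨hy, hpy⟩⟩
    obtain ⟨hqC, hpq⟩ := Finset.mem_filter.1 hq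
    refine support_of_D (r := p) (s := q) hp (by rintro rfl; exact lt_irrefl _ hpq)
      (Or.inl rfl) ?_
    intro x hx
    by_cases hxp : x = p
    · subst hxp; unfold D; apply le_of_eq; ring
    by_cases hxq : x = q
    · subst hxq; unfold D; apply le_of_eq; ring
    rcases lt_or_gt_of_ne (fun e => hxp (hinj hx hp e)) with h | h
    · have := hC x hx p hp q hqC h hpq
      rw [← D_rot] at this; exact this.le
    · have h' := hqm x (Finset.mem_filter.2 ⟨hx, h⟩)
      exact (hC p hp q hqC x hx hpq (lt_of_le_of_ne h' fun e => hxq (hinj hx hqC e.symm))).le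
  · push Not at hmax
    obtain ⟨q, hq, hqm⟩ := Finset.exists_min_image C (H α β) ⟨p, hp⟩
    by_cases hqp : q = p
    · subst hqp
      refine frontier_of_support (v := !₂[1, 0]) hp ?_ ?_
      · intro h0
        have h1 := congrArg (fun z : Pt => z 0) h0
        simp at h1
      · intro y hy
        rw [hinj hy hp (le_antisymm (hmax y hy) (hqm y hy))]
    · refine support_of_D (r := p) (s := q) hp (Ne.symm hqp) (Or.inl rfl) ?_
      intro x hx
      by_cases hxp : x = p
      · subst hxp; unfold D; apply le_of_eq; ring
      by_cases hxq : x = q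
      · subst hxq; unfold D; apply le_of_eq; ring
      have := hC q hq x hx p hp (lt_of_le_of_ne (hqm x hx) fun e => hxq (hinj hx hq e.symm))
        (lt_of_le_of_ne (hmax x hx) fun e => hxp (hinj hx hp e))
      have e : D p q x = D q x p := by unfold D; ring
      rw [e]; exact this.le

lemma exists_generic (P : Finset Pt) : ∃ β : ℝ, Set.InjOn (H 1 β) P := by
  classical
  obtain ⟨β, hβ⟩ := Infinite.exists_notMem_finset
    ((P ×ˢ P).image fun z : Pt × Pt => -(z.1 0 - z.2 0) / (z.1 1 - z.2 1))
  refine ⟨β, fun a ha b hb e => ?_⟩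
  unfold H at e
  by_cases h1 : a 1 = b 1
  · exact pt_ext (by rw [h1] at e; linarith) h1
  · exfalso
    apply hβ
    refine Finset.mem_image.2 ⟨(a, b), Finset.mem_product.2 ⟨ha, hb⟩, ?_⟩
    have : a 1 - b 1 ≠ 0 := sub_ne_zero.2 h1
    simp only
    field_simp
    linarith

lemma ES_finite (m : ℕ) : ∃ N : ℕ, ∀ P : Finset Pt, GenPos P → N ≤ P.card → HasConvex P m := by
  obtain ⟨N, hN⟩ := cupcap m m
  refine ⟨N, fun P hP hc => ?_⟩
  obtain ⟨β, hβ⟩ := exists_generic P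
  have key : ∃ C ⊆ P, C.card = m + 2 ∧ ∃ a b, Cup a b C ∧ Set.InjOn (H a b) C := by
    rcases hN 1 β P hβ ((genPos_iff P).1 hP) hc with ⟨C, h1, h2, h3⟩ | ⟨C, h1, h2, h3⟩
    · exact ⟨C, h1, h2, 1, β, h3, hβ.mono (by exact_mod_cast h1)⟩
    · exact ⟨C, h1, h2, -1, -β, h3, injOn_neg (hβ.mono (by exact_mod_cast h1))⟩
  obtain ⟨C, hCP, hCc, a, b, hcup, hi⟩ := key
  obtain ⟨E, hE, hEc⟩ := Finset.exists_subset_card_eq (show m ≤ C.card by omega)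
  exact ⟨E, hE.trans hCP, hEc, cup_convex
    (fun a ha b hb c hc => hcup a (hE ha) b (hE hb) c (hE hc)) (hi.mono (by exact_mod_cast hE))⟩

lemma ES_spec (m : ℕ) (P : Finset Pt) (hP : GenPos P) (hc : ES m ≤ P.card) : HasConvex P m := by
  have : ES m ∈ {n : ℕ | ∀ P : Finset Pt, GenPos P → n ≤ P.card → HasConvex P m} :=
    Nat.sInf_mem (ES_finite m)
  exact this P hP hc

lemma quad_ne (A B C : ℝ) (h : B ≠ 0 ∨ C ≠ 0) :
    ∀ᶠ t in nhdsWithin (0:ℝ) {0}ᶜ, A + B * t + C * t ^ 2 ≠ 0 := by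
  apply Filter.Eventually.filter_mono (nhdsNE_le_cofinite (0:ℝ))
  rw [Filter.eventually_cofinite]
  set p : Polynomial ℝ := Polynomial.C A + Polynomial.C B * Polynomial.X
    + Polynomial.C C * Polynomial.X ^ 2 with hp
  have hp0 : p ≠ 0 := by
    intro h0
    have h1 := congrArg (fun q => Polynomial.coeff q 1) h0
    have h2 := congrArg (fun q => Polynomial.coeff q 2) h0
    simp [hp, Polynomial.coeff_X, Polynomial.coeff_C] at h1 h2
    rcases h with h | h
    · exact h h1
    · exact h h2
  refine p.roots.toFinset.finite_toSet.subset ?_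
  intro t ht
  have ht : A + B * t + C * t ^ 2 = 0 := by simpa using ht
  have hp1 := hp0
  rw [hp] at hp1
  simp [hp, ht]
  exact hp1

lemma perturb (P : Finset Pt) (ε : ℝ) (hε : 0 < ε) : ∃ φ : Pt → Pt, Set.InjOn φ P ∧
    NoCol (P.image φ) ∧ ∀ p ∈ P, ‖φ p - p‖ < ε := by
  obtain ⟨c, hc⟩ : ∃ c : Pt → ℕ, Set.InjOn c P := Set.countable_iff_exists_injOn.1 P.countable_toSet
  have hcr : ∀ a ∈ P, ∀ b ∈ P, a ≠ b → (c b : ℝ) - c a ≠ 0 := by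
    intro a ha b hb hab h0
    have : (c b : ℝ) = c a := by linarith
    exact hab (hc ha hb (by exact_mod_cast this.symm))
  set φ : ℝ → Pt → Pt := fun t p => p + t • !₂[(c p : ℝ), (c p : ℝ) ^ 2] with hφ
  have e1 : ∀ᶠ t in nhdsWithin (0:ℝ) {0}ᶜ, ∀ a ∈ P, ∀ b ∈ P, a ≠ b → φ t a ≠ φ t b := by
    simp only [Filter.eventually_all_finset]
    intro a ha b hb
    by_cases hab : a = b
    · simp [hab]
    filter_upwards [quad_ne (b 0 - a 0) (c b - c a) 0 (Or.inl (hcr a ha b hb hab))] with t ht _ he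
    apply ht
    have h1 := congrArg (fun z : Pt => z 0) he
    simp [hφ] at h1
    linarith
  have e2 : ∀ᶠ t in nhdsWithin (0:ℝ) {0}ᶜ, ∀ a ∈ P, ∀ b ∈ P, ∀ d ∈ P, a ≠ b → b ≠ d → a ≠ d →
      D (φ t a) (φ t b) (φ t d) ≠ 0 := by
    simp only [Filter.eventually_all_finset]
    intro a ha b hb d hd
    by_cases hab : a = b
    · simp [hab]
    by_cases hbd : b = d
    · simp [hbd]
    by_cases had : a = d
    · simp [had]
    have hC : ((c b : ℝ) - c a) * ((c d : ℝ) - c a) * ((c d : ℝ) - c b) ≠ 0 :=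
      mul_ne_zero (mul_ne_zero (hcr a ha b hb hab) (hcr a ha d hd had)) (hcr b hb d hd hbd)
    filter_upwards [quad_ne (D a b d)
      ((b 0 - a 0) * ((c d : ℝ) ^ 2 - (c a : ℝ) ^ 2) + ((c b : ℝ) - c a) * (d 1 - a 1)
        - (b 1 - a 1) * ((c d : ℝ) - c a) - ((c b : ℝ) ^ 2 - (c a : ℝ) ^ 2) * (d 0 - a 0))
      _ (Or.inr hC)] with t ht _ _ _ he
    apply ht
    rw [← he]
    simp [hφ, D]
    ring
  have e3 : ∀ᶠ t in nhdsWithin (0:ℝ) {0}ᶜ, ∀ p ∈ P, ‖φ t p - p‖ < ε := by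
    simp only [Filter.eventually_all_finset]
    intro p _
    have hcont : Continuous (fun t : ℝ => ‖φ t p - p‖) := by
      simp only [hφ]; fun_prop
    have h0 : ‖φ 0 p - p‖ < ε := by simpa [hφ] using hε
    exact (hcont.tendsto 0 |>.eventually (gt_mem_nhds h0)).filter_mono nhdsWithin_le_nhds
  obtain ⟨t, h1, h2, h3⟩ := (e1.and (e2.and e3)).exists
  refine ⟨φ t, ?_, ?_, h3⟩
  · intro a ha b hb he
    by_contra hab
    exact h1 a ha b hb hab he
  · intro x hx y hy z hz hcol
    obtain ⟨a, ha, rfl⟩ := Finset.mem_image.1 hx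
    obtain ⟨b, hb, rfl⟩ := Finset.mem_image.1 hy
    obtain ⟨d, hd, rfl⟩ := Finset.mem_image.1 hz
    obtain ⟨k1, k2, k3, k4⟩ := hcol
    exact h2 a ha b hb d hd (fun h => k1 (by rw [h])) (fun h => k2 (by rw [h]))
      (fun h => k3 (by rw [h])) k4

/-- Approximate support at a frontier point. -/
lemma approx_support {S : Finset Pt} {p : Pt} (hp : p ∈ frontier (convexHull ℝ (S : Set Pt)))
    (hne : S.Nonempty)
    (ε : ℝ) (hε : 0 < ε) : ∃ v : Pt, ‖v‖ = 1 ∧ ∀ y ∈ S, ⟪v, y⟫ ≤ ⟪v, p⟫ + ε := by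
  have hcl : p ∈ closure (convexHull ℝ (S : Set Pt))ᶜ := by
    rw [frontier_eq_closure_inter_closure] at hp
    exact hp.2
  obtain ⟨q, hq, hpq⟩ := Metric.mem_closure_iff.1 hcl ε hε
  have hclosed : IsClosed (convexHull ℝ (S : Set Pt)) :=
    (S.finite_toSet.isCompact_convexHull (𝕜 := ℝ)).isClosed
  obtain ⟨f, u, hf, hu⟩ := geometric_hahn_banach_closed_point (convex_convexHull ℝ _) hclosed hq
  set w := (InnerProductSpace.toDual ℝ Pt).symm f with hw
  have hin : ∀ x, ⟪w, x⟫ = f x := fun x => by simp [hw]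
  have hlt : ∀ y ∈ S, ⟪w, y⟫ < ⟪w, q⟫ := by
    intro y hy
    rw [hin, hin]
    exact (hf y (subset_convexHull ℝ _ hy)).trans hu
  have hw0 : w ≠ 0 := by
    intro h0
    obtain ⟨y, hy⟩ := hne
    have := hlt y hy
    simp [h0] at this
  have hwn : 0 < ‖w‖ := norm_pos_iff.2 hw0
  have hn1 : ‖(‖w‖⁻¹ • w)‖ = 1 := by
    rw [norm_smul, norm_inv, norm_norm, inv_mul_cancel₀ hwn.ne']
  refine ⟨‖w‖⁻¹ • w, hn1, fun y hy => ?_⟩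
  have h1 : ⟪‖w‖⁻¹ • w, y⟫ ≤ ⟪‖w‖⁻¹ • w, q⟫ := by
    rw [real_inner_smul_left, real_inner_smul_left]
    exact mul_le_mul_of_nonneg_left (hlt y hy).le (by positivity)
  have h2 : ⟪‖w‖⁻¹ • w, q - p⟫ ≤ ‖q - p‖ := by
    have := real_inner_le_norm (‖w‖⁻¹ • w) (q - p)
    rwa [hn1, one_mul] at this
  rw [inner_sub_right] at h2
  rw [dist_comm, dist_eq_norm] at hpq
  linarith

lemma W_of_approx {S : Finset Pt} (h : ∀ p ∈ S, ∀ ε : ℝ, 0 < ε →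
    ∃ v : Pt, ‖v‖ = 1 ∧ ∀ y ∈ S, ⟪v, y⟫ ≤ ⟪v, p⟫ + ε) : W S := by
  intro p hp
  have hcont : Continuous (fun v : Pt => S.sup' ⟨p, hp⟩ fun y => ⟪v, y⟫ - ⟪v, p⟫) :=
    Continuous.finset_sup'_apply _ fun y _ => by fun_prop
  obtain ⟨v0, hv0, _⟩ := h p hp 1 one_pos
  obtain ⟨v, hv, hmin⟩ := (isCompact_sphere (0 : Pt) 1).exists_isMinOn
    ⟨v0, by simpa using hv0⟩ hcont.continuousOn
  refine ⟨v, fun h0 => by simp [h0] at hv, fun y hy => ?_⟩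
  apply le_of_forall_pos_le_add
  intro ε hε
  obtain ⟨w, hw, hwy⟩ := h p hp ε hε
  have h1 := hmin (show w ∈ Metric.sphere (0 : Pt) 1 by simpa using hw)
  change (S.sup' ⟨p, hp⟩ fun y => ⟪v, y⟫ - ⟪v, p⟫) ≤ S.sup' ⟨p, hp⟩ fun y => ⟪w, y⟫ - ⟪w, p⟫ at h1
  have h2 : (S.sup' ⟨p, hp⟩ fun y => ⟪w, y⟫ - ⟪w, p⟫) ≤ ε :=
    Finset.sup'_le _ _ fun z hz => by have := hwy z hz; linarith
  have h3 := Finset.le_sup' (fun y => ⟪v, y⟫ - ⟪v, p⟫) hy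
  linarith

lemma approx_one (P : Finset Pt) (m : ℕ) (hP : ES m ≤ P.card) (ε : ℝ) (hε : 0 < ε) :
    ∃ S ⊆ P, S.card = m ∧ ∀ p ∈ S, ∃ v : Pt, ‖v‖ = 1 ∧ ∀ y ∈ S, ⟪v, y⟫ ≤ ⟪v, p⟫ + ε := by
  obtain ⟨φ, hinj, hno, hd⟩ := perturb P (ε / 3) (by linarith)
  obtain ⟨S', hS', hc, hconv⟩ := ES_spec m (P.image φ) ((genPos_iff _).2 hno)
    (by rw [Finset.card_image_of_injOn hinj]; exact hP)
  obtain ⟨S, hSP, rfl⟩ := Finset.subset_image_iff.1 hS'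
  have hSP' : S ⊆ P := by exact_mod_cast hSP
  refine ⟨S, hSP', ?_, ?_⟩
  · rwa [Finset.card_image_of_injOn (hinj.mono hSP)] at hc
  · intro p hp
    have hpi : φ p ∈ S.image φ := Finset.mem_image_of_mem _ hp
    obtain ⟨v, hv, h⟩ := approx_support (hconv (φ p) hpi) ⟨_, hpi⟩ (ε / 3) (by linarith)
    refine ⟨v, hv, fun y hy => ?_⟩
    have h1 := h (φ y) (Finset.mem_image_of_mem _ hy)
    have h2 : ∀ z ∈ S, |⟪v, φ z - z⟫| ≤ ε / 3 := by
      intro z hz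
      have := abs_real_inner_le_norm v (φ z - z)
      rw [hv, one_mul] at this
      exact this.trans (hd z (hSP' hz)).le
    have hy2 := abs_le.1 (h2 y hy)
    have hp2 := abs_le.1 (h2 p hp)
    rw [inner_sub_right] at hy2 hp2
    linarith [hy2.1, hp2.2]

lemma exists_W (P : Finset Pt) (m : ℕ) (hP : ES m ≤ P.card) :
    ∃ S ⊆ P, S.card = m ∧ W S := by
  have hall : ∀ n : ℕ, ∃ S : {S : Finset Pt // S ∈ P.powerset}, S.1.card = m ∧
      ∀ p ∈ S.1, ∃ v : Pt, ‖v‖ = 1 ∧ ∀ y ∈ S.1, ⟪v, y⟫ ≤ ⟪v, p⟫ + 1 / ((n : ℝ) + 1) := by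
    intro n
    obtain ⟨S, h1, h2⟩ := approx_one P m hP (1 / ((n : ℝ) + 1)) (by positivity)
    exact ⟨⟨S, Finset.mem_powerset.2 h1⟩, h2⟩
  choose f hf1 hf2 using hall
  obtain ⟨S, hS⟩ := Finite.exists_infinite_fiber f
  have hinf : (f ⁻¹' {S}).Infinite := Set.infinite_coe_iff.1 hS
  obtain ⟨n0, hn0⟩ := hinf.nonempty
  have hn0' : f n0 = S := hn0
  refine ⟨S.1, Finset.mem_powerset.1 S.2, by rw [← hn0']; exact hf1 n0, W_of_approx ?_⟩
  intro p hp ε hε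
  obtain ⟨k, hk⟩ := exists_nat_one_div_lt hε
  obtain ⟨n, hn, hkn⟩ := hinf.exists_gt k
  have hn' : f n = S := hn
  have h2 := hf2 n
  rw [hn'] at h2
  obtain ⟨v, hv, h⟩ := h2 p hp
  refine ⟨v, hv, fun y hy => (h y hy).trans ?_⟩
  have : 1 / ((n : ℝ) + 1) ≤ 1 / ((k : ℝ) + 1) := by
    apply one_div_le_one_div_of_le (by positivity)
    have : (k : ℝ) ≤ n := by exact_mod_cast hkn.le
    linarith
  linarith

end ESK

theorem stmt10 (l k : ℕ) (hl : 3 ≤ l) (hk : 3 ≤ k) (hodd : Odd k)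
    (P : Finset Pt) (hP : ES ((k - 1) * (l - 1) / 2 + 1) ≤ P.card) :
    HasCollinear P l ∨ HasStrictConvex P k := by
  by_cases hcol : HasCollinear P l
  · exact Or.inl hcol
  right
  obtain ⟨j, rfl⟩ := hodd
  have e : (2 * j + 1 - 1) * (l - 1) / 2 + 1 = j * (l - 1) + 1 := by
    rw [Nat.add_sub_cancel, mul_assoc, Nat.mul_div_cancel_left _ (by norm_num)]
  rw [e] at hP
  obtain ⟨S, hSP, hSc, hW⟩ := ESK.exists_W P _ hP
  obtain ⟨T, hTS, hTc, hT⟩ := ESK.main_ind l hl j S hW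
    (fun ⟨U, hU, h⟩ => hcol ⟨U, hU.trans hSP, h⟩) hSc.ge
  exact ⟨T, hTS.trans hSP, hTc, ESK.strict_of (hW.mono hTS) hT⟩
end
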